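/- arXiv:2404.00295 — 4 statements merged into one kernel-verified Lean document; each statement's English description precedes it below -/
import Mathlib

section
/- Let p ≥ 2 and m ≥ 1 be integers, let a_1,…,a_p ∈ ℂ, and let b_{j,k} ∈ ℂ for 1 ≤ j ≤ p, 1 ≤ k ≤ m with b_{p,k} = 1 for all k. Assume (i) a_i − Σ_{k=1}^m b_{j_k,k} ∉ ℤ for every 1 ≤ i ≤ p and every J = (j_1,…,j_m) ∈ {1,…,p}^m, and (ii) b_{j,k} − b_{j',k} ∉ ℤ for all 1 ≤ j < j' ≤ p and all k. Fix J = (j_1,…,j_m) ∈ {1,…,p}^m and set μ_{J,k} = 1 − b_{j_k,k}, Σ_J = Σ_{k=1}^m μ_{J,k}, a'_i = a_i + Σ_J, and b'_{j,k} = b_{j,k} + (1 − b_{j_k,k})·(1 + δ_{j,j_k} − δ_{j,p}) for 1 ≤ j ≤ p (so that b'_{p,k} = 1). Let U = {x ∈ ℝ^m : 0 < x_k for all k and x_1^{1/p}+⋯+x_m^{1/p} < 1}, and define Φ_J : U → ℂ by Φ_J(x) = (∏_{k=1}^m exp(μ_{J,k}·log x_k)) · Σ_{n∈ℕ^m} A'_n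 x_1^{n_1}⋯x_m^{n_m}, where A'_n = (∏_{i=1}^p (a'_i)_{|n|}) / (∏_{k=1}^m (b'_{1,k})_{n_k}⋯(b'_{p−1,k})_{n_k}·n_k!). Then for every k with 1 ≤ k ≤ m and every x ∈ U, (θ_k ∘ (θ_k + (b_{1,k}−1)) ∘ ⋯ ∘ (θ_k + (b_{p−1,k}−1)))Φ_J(x) = x_k·((Θ + a_1) ∘ ⋯ ∘ (Θ + a_p))Φ_J(x). -/
open scoped BigOperators

/-- The Euler operator `θ_k = x_k ∂/∂x_k` acting on functions `ℝ^m → ℂ`. -/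
noncomputable def eulerOpR (m : ℕ) (k : Fin m) (g : (Fin m → ℝ) → ℂ) :
    (Fin m → ℝ) → ℂ :=
  fun x => (x k : ℂ) * fderiv ℝ g x (Pi.single k 1)

/-- The operator `Θ = θ_1 + ⋯ + θ_m`. -/
noncomputable def eulerSumR (m : ℕ) (g : (Fin m → ℝ) → ℂ) : (Fin m → ℝ) → ℂ :=
  fun x => ∑ k, eulerOpR m k g x

/-- For an operator `T` and a constant `c`, the operator `T + c` sending `g` to `Tg + c·g`. -/
noncomputable def opAddConstR (m : ℕ)
    (T : ((Fin m → ℝ) → ℂ) → ((Fin m → ℝ) → ℂ)) (c : ℂ) :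
    ((Fin m → ℝ) → ℂ) → ((Fin m → ℝ) → ℂ) :=
  fun g x => T g x + c * g x

/-- The power function `x ↦ ∏ k, x_k ^ s_k` with complex exponents, for positive `x_k`. -/
noncomputable def cpowMonomial {m : ℕ} (s : Fin m → ℂ) (x : Fin m → ℝ) : ℂ :=
  ∏ k, Complex.exp (s k * (Real.log (x k) : ℂ))

/-- The logarithmic derivative of `cpowMonomial s`. -/
noncomputable def cpowMonomialLogDeriv {m : ℕ} (s : Fin m → ℂ) (x : Fin m → ℝ) :
    (Fin m → ℝ) →L[ℝ] ℂ :=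
  ∑ k, (s k / (x k : ℂ)) • (Complex.ofRealCLM.comp (ContinuousLinearMap.proj k))

lemma cpowMonomialLogDeriv_single {m : ℕ} (s : Fin m → ℂ) (x : Fin m → ℝ) (k : Fin m) :
    cpowMonomialLogDeriv s x (Pi.single k 1) = s k / (x k : ℂ) := by
  simp only [cpowMonomialLogDeriv, sum_apply, smul_apply,
    ContinuousLinearMap.comp_apply, ContinuousLinearMap.proj_apply, Complex.ofRealCLM_apply,
    smul_eq_mul]
  rw [Finset.sum_eq_single k]
  · simp
  · intro j _ hj
    simp [Pi.single_eq_of_ne hj]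
  · simp

lemma hasFDerivAt_cpowMonomial {m : ℕ} (s : Fin m → ℂ) {x : Fin m → ℝ} (hx : ∀ k, 0 < x k) :
    HasFDerivAt (cpowMonomial s) (cpowMonomial s x • cpowMonomialLogDeriv s x) x := by
  have hlog : ∀ k : Fin m, HasFDerivAt (fun y : Fin m → ℝ => s k * (Real.log (y k) : ℂ))
      ((s k / (x k : ℂ)) • (Complex.ofRealCLM.comp (ContinuousLinearMap.proj (R := ℝ) k))) x := by
    intro k
    have h := (Complex.ofRealCLM.hasFDerivAt.comp x
      ((hasFDerivAt_apply k x).log (hx k).ne')).const_mul (s k)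
    refine h.congr_fderiv ?_
    ext v
    simp [div_eq_mul_inv, mul_assoc]
  have h := (HasFDerivAt.fun_sum fun k (_ : k ∈ Finset.univ) => hlog k).cexp
  have he : cpowMonomial s =
      fun y : Fin m → ℝ => Complex.exp (∑ k, s k * (Real.log (y k) : ℂ)) := by
    funext y
    rw [cpowMonomial, Complex.exp_sum]
  rw [he]
  exact h

lemma cpowMonomial_natCast {m : ℕ} (n : Fin m → ℕ) {x : Fin m → ℝ} (hx : ∀ k, 0 < x k) :
    cpowMonomial (fun k => (n k : ℂ)) x = ∏ k, (x k : ℂ) ^ n k := by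
  refine Finset.prod_congr rfl fun k _ => ?_
  rw [Complex.exp_nat_mul, ← Complex.ofReal_exp, Real.exp_log (hx k)]

lemma hasFDerivAt_monomial {m : ℕ} (n : Fin m → ℕ) {x : Fin m → ℝ} (hx : ∀ k, 0 < x k) :
    HasFDerivAt (fun y : Fin m → ℝ => ∏ k, (y k : ℂ) ^ n k)
      ((∏ k, (x k : ℂ) ^ n k) • cpowMonomialLogDeriv (fun k => (n k : ℂ)) x) x := by
  have h := hasFDerivAt_cpowMonomial (fun k => (n k : ℂ)) hx
  rw [cpowMonomial_natCast n hx] at h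
  refine h.congr_of_eventuallyEq ?_
  have hev : ∀ᶠ y : Fin m → ℝ in nhds x, ∀ k, 0 < y k :=
    Filter.eventually_all.2 fun k =>
      (continuous_apply k).continuousAt.eventually (lt_mem_nhds (hx k))
  filter_upwards [hev] with y hy
  exact (cpowMonomial_natCast n hy).symm

lemma norm_cpowMonomialLogDeriv_le {m : ℕ} (s : Fin m → ℂ) {x : Fin m → ℝ}
    (hx : ∀ k, 0 < x k) : ‖cpowMonomialLogDeriv s x‖ ≤ ∑ k, ‖s k‖ / x k := by
  refine (norm_sum_le _ _).trans (Finset.sum_le_sum fun k _ => ?_)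
  rw [norm_smul, norm_div, Complex.norm_real, Real.norm_of_nonneg (hx k).le]
  refine mul_le_of_le_one_right (div_nonneg (norm_nonneg _) (hx k).le) ?_
  refine ContinuousLinearMap.opNorm_le_bound _ zero_le_one fun v => ?_
  simpa using norm_le_pi_norm v k

/-- The region `x_k > 0`, `∑ k, x_k ^ (1 / p) < 1`. -/
def lauricellaRegion (p m : ℕ) : Set (Fin m → ℝ) :=
  {x | (∀ k, 0 < x k) ∧ ∑ k, x k ^ ((p : ℝ)⁻¹) < 1}

lemma isOpen_lauricellaRegion (p m : ℕ) : IsOpen (lauricellaRegion p m) := by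
  have h1 : IsOpen {x : Fin m → ℝ | ∀ k, 0 < x k} := by
    simp only [Set.ofPred_forall]
    exact isOpen_iInter_of_finite fun k => isOpen_lt continuous_const (continuous_apply k)
  have h2 : IsOpen {x : Fin m → ℝ | ∑ k, x k ^ ((p : ℝ)⁻¹) < 1} := by
    refine isOpen_lt (continuous_finsetSum _ fun k _ => ?_) continuous_const
    exact (continuous_apply k).rpow_const fun _ => Or.inr (by positivity)
  exact h1.inter h2

lemma exists_one_lt_mul_mem_lauricellaRegion {p m : ℕ} {x : Fin m → ℝ}
    (hx : x ∈ lauricellaRegion p m) :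
    ∃ t : ℝ, 1 < t ∧ (fun k => t * x k) ∈ lauricellaRegion p m := by
  have hc : ContinuousAt (fun t : ℝ => fun k : Fin m => t * x k) 1 :=
    (continuous_pi fun k => continuous_id.mul continuous_const).continuousAt
  have hmem : lauricellaRegion p m ∈ nhds ((fun t : ℝ => fun k : Fin m => t * x k) 1) := by
    simpa using (isOpen_lauricellaRegion p m).mem_nhds hx
  have h := nhdsWithin_le_nhds (s := Set.Ioi (1 : ℝ)) (hc.preimage_mem_nhds hmem)
  obtain ⟨t, ht, ht1⟩ := (Filter.nonempty_of_mem (Filter.inter_mem h self_mem_nhdsWithin))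
  exact ⟨t, ht1, ht⟩

/-- Absolute convergence on `lauricellaRegion p m` of the power series with coefficients `c`. -/
def AbsConvergent (p : ℕ) {m : ℕ} (c : (Fin m → ℕ) → ℂ) : Prop :=
  ∀ x ∈ lauricellaRegion p m, Summable fun n : Fin m → ℕ => ‖c n‖ * ∏ k, x k ^ n k

namespace AbsConvergent

variable {p m : ℕ} {c d : (Fin m → ℕ) → ℂ}

lemma add (hc : AbsConvergent p c) (hd : AbsConvergent p d) :
    AbsConvergent p fun n => c n + d n := by
  intro x hx
  have hp : ∀ n : Fin m → ℕ, 0 ≤ ∏ k, x k ^ n k := fun n =>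
    Finset.prod_nonneg fun k _ => pow_nonneg (hx.1 k).le _
  refine Summable.of_nonneg_of_le (fun n => mul_nonneg (norm_nonneg _) (hp n)) (fun n => ?_)
    ((hc x hx).add (hd x hx))
  rw [← add_mul]
  exact mul_le_mul_of_nonneg_right (norm_add_le _ _) (hp n)

lemma const_mul (hc : AbsConvergent p c) (z : ℂ) : AbsConvergent p fun n => z * c n := by
  intro x hx
  simpa only [norm_mul, mul_assoc] using (hc x hx).mul_left ‖z‖

lemma natCast_mul (hc : AbsConvergent p c) (j : Fin m) :
    AbsConvergent p fun n => (n j : ℂ) * c n := by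
  intro x hx
  obtain ⟨t, ht, htx⟩ := exists_one_lt_mul_mem_lauricellaRegion hx
  have hp : ∀ n : Fin m → ℕ, 0 ≤ ∏ k, x k ^ n k := fun n =>
    Finset.prod_nonneg fun k _ => pow_nonneg (hx.1 k).le _
  refine Summable.of_nonneg_of_le (fun n => mul_nonneg (norm_nonneg _) (hp n)) (fun n => ?_)
    ((hc _ htx).mul_left (t - 1)⁻¹)
  have h1 : (n j : ℝ) ≤ (t - 1)⁻¹ * t ^ ∑ k, n k := by
    refine (Nat.cast_le_pow_div_sub ht (n j)).trans ?_
    rw [div_eq_inv_mul]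
    refine mul_le_mul_of_nonneg_left ?_ (inv_nonneg.2 (sub_nonneg.2 ht.le))
    exact pow_le_pow_right₀ ht.le
      (Finset.single_le_sum (f := n) (fun _ _ => Nat.zero_le _) (Finset.mem_univ j))
  calc ‖(n j : ℂ) * c n‖ * ∏ k, x k ^ n k
      = n j * (‖c n‖ * ∏ k, x k ^ n k) := by rw [norm_mul, Complex.norm_natCast, mul_assoc]
    _ ≤ ((t - 1)⁻¹ * t ^ ∑ k, n k) * (‖c n‖ * ∏ k, x k ^ n k) :=
        mul_le_mul_of_nonneg_right h1 (mul_nonneg (norm_nonneg _) (hp n))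
    _ = (t - 1)⁻¹ * (‖c n‖ * ∏ k, (t * x k) ^ n k) := by
        simp_rw [mul_pow]
        rw [Finset.prod_mul_distrib, Finset.prod_pow_eq_pow_sum]
        ring

lemma summable (hc : AbsConvergent p c) {x : Fin m → ℝ} (hx : x ∈ lauricellaRegion p m) :
    Summable fun n : Fin m → ℕ => c n * ∏ k, (x k : ℂ) ^ n k := by
  refine Summable.of_norm ((hc x hx).congr fun n => ?_)
  rw [norm_mul, norm_prod]
  congr 1
  refine Finset.prod_congr rfl fun k _ => ?_
  rw [norm_pow, Complex.norm_real, Real.norm_of_nonneg (hx.1 k).le]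

/-- Term-by-term differentiation of the power series with coefficients `c`. -/
lemma hasFDerivAt_tsum (hc : AbsConvergent p c) {x : Fin m → ℝ}
    (hx : x ∈ lauricellaRegion p m) :
    ∃ L : (Fin m → ℝ) →L[ℝ] ℂ,
      HasFDerivAt (fun y : Fin m → ℝ => ∑' n : Fin m → ℕ, c n * ∏ k, (y k : ℂ) ^ n k) L x ∧
      ∀ j, (x j : ℂ) * L (Pi.single j 1) =
        ∑' n : Fin m → ℕ, (n j * c n) * ∏ k, (x k : ℂ) ^ n k := by
  obtain ⟨t, ht, htx⟩ := exists_one_lt_mul_mem_lauricellaRegion hx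
  let s : Set (Fin m → ℝ) := Set.pi Set.univ fun k => Set.Ioo (x k / 2) (t * x k)
  have hs : IsOpen s := isOpen_set_pi Set.finite_univ fun k _ => isOpen_Ioo
  have hs' : IsPreconnected s := isPreconnected_univ_pi fun k => isPreconnected_Ioo
  have hxs : x ∈ s := fun k _ => ⟨half_lt_self (hx.1 k), lt_mul_of_one_lt_left (hx.1 k) ht⟩
  have hpos : ∀ y ∈ s, ∀ k, 0 < y k := fun y hy k =>
    (half_pos (hx.1 k)).trans (hy k trivial).1
  let u : (Fin m → ℕ) → ℝ := fun n =>
    ∑ j, (2 / x j) * (‖(n j : ℂ) * c n‖ * ∏ k, (t * x k) ^ n k)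
  have hu : Summable u := summable_sum fun j _ => (hc.natCast_mul j _ htx).mul_left _
  let f' : (Fin m → ℕ) → (Fin m → ℝ) → (Fin m → ℝ) →L[ℝ] ℂ := fun n y =>
    c n • ((∏ k, (y k : ℂ) ^ n k) • cpowMonomialLogDeriv (fun k => (n k : ℂ)) y)
  have hf' : ∀ n y, y ∈ s → ‖f' n y‖ ≤ u n := by
    intro n y hy
    have hyp := hpos y hy
    have h1 : ‖∏ k, (y k : ℂ) ^ n k‖ ≤ ∏ k, (t * x k) ^ n k := by
      rw [norm_prod]
      refine Finset.prod_le_prod (fun _ _ => norm_nonneg _) fun k _ => ?_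
      rw [norm_pow, Complex.norm_real, Real.norm_of_nonneg (hyp k).le]
      exact pow_le_pow_left₀ (hyp k).le (hy k trivial).2.le _
    have h2 : ‖cpowMonomialLogDeriv (fun k => (n k : ℂ)) y‖ ≤ ∑ j, (2 / x j) * n j := by
      refine (norm_cpowMonomialLogDeriv_le _ hyp).trans (Finset.sum_le_sum fun j _ => ?_)
      rw [Complex.norm_natCast, div_eq_inv_mul, ← inv_div]
      refine mul_le_mul_of_nonneg_right ?_ (Nat.cast_nonneg _)
      exact inv_anti₀ (half_pos (hx.1 j)) (hy j trivial).1.le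
    calc ‖f' n y‖ = ‖c n‖ * (‖∏ k, (y k : ℂ) ^ n k‖ *
          ‖cpowMonomialLogDeriv (fun k => (n k : ℂ)) y‖) := by
          simp only [f', norm_smul]
      _ ≤ ‖c n‖ * ((∏ k, (t * x k) ^ n k) * ∑ j, (2 / x j) * n j) := by
          gcongr
          exact (norm_nonneg _).trans h1
      _ = u n := by
          simp only [u, Finset.mul_sum, norm_mul, Complex.norm_natCast]
          exact Finset.sum_congr rfl fun j _ => by ring
  refine ⟨∑' n, f' n x, hasFDerivAt_tsum_of_isPreconnected hu hs hs'
    (fun n y hy => (hasFDerivAt_monomial n (hpos y hy)).const_mul (c n)) hf' hxs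
    (hc.summable hx) hxs, fun j => ?_⟩
  have hsum : Summable fun n => f' n x :=
    Summable.of_norm_bounded hu fun n => hf' n x hxs
  have happ := ((ContinuousLinearMap.apply ℝ ℂ (Pi.single j (1 : ℝ))).map_tsum hsum)
  simp only [ContinuousLinearMap.apply_apply] at happ
  rw [happ, ← tsum_mul_left]
  refine tsum_congr fun n => ?_
  have hxj : (x j : ℂ) ≠ 0 := Complex.ofReal_ne_zero.2 (hx.1 j).ne'
  simp only [f', smul_apply, cpowMonomialLogDeriv_single, smul_eq_mul]
  field_simp

end AbsConvergent

/-- On `lauricellaRegion p m` the function `g` is `x ^ μ` times the absolutely convergent power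
series with coefficients `c`. -/
def HasPowExpansion (p : ℕ) {m : ℕ} (μ : Fin m → ℂ) (c : (Fin m → ℕ) → ℂ)
    (g : (Fin m → ℝ) → ℂ) : Prop :=
  AbsConvergent p c ∧ ∀ x ∈ lauricellaRegion p m,
    g x = cpowMonomial μ x * ∑' n : Fin m → ℕ, c n * ∏ k, (x k : ℂ) ^ n k

namespace HasPowExpansion

variable {p m : ℕ} {μ : Fin m → ℂ} {c d : (Fin m → ℕ) → ℂ} {g h : (Fin m → ℝ) → ℂ}

lemma add (hg : HasPowExpansion p μ c g) (hh : HasPowExpansion p μ d h) :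
    HasPowExpansion p μ (fun n => c n + d n) fun x => g x + h x := by
  refine ⟨hg.1.add hh.1, fun x hx => ?_⟩
  simp only [hg.2 x hx, hh.2 x hx, add_mul]
  rw [(hg.1.summable hx).tsum_add (hh.1.summable hx), mul_add]

lemma const_mul (hg : HasPowExpansion p μ c g) (z : ℂ) :
    HasPowExpansion p μ (fun n => z * c n) fun x => z * g x := by
  refine ⟨hg.1.const_mul z, fun x hx => ?_⟩
  simp only [hg.2 x hx, mul_assoc]
  rw [tsum_mul_left]
  ring

lemma sum {ι : Type*} (s : Finset ι) {c : ι → (Fin m → ℕ) → ℂ}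
    {g : ι → (Fin m → ℝ) → ℂ} (hg : ∀ i, HasPowExpansion p μ (c i) (g i)) :
    HasPowExpansion p μ (fun n => ∑ i ∈ s, c i n) fun x => ∑ i ∈ s, g i x := by
  classical
  induction s using Finset.induction_on with
  | empty =>
    refine ⟨fun x _ => ?_, fun x _ => ?_⟩
    · simp
    · simp
  | insert i s hi ih => simpa only [Finset.sum_insert hi] using (hg i).add ih

lemma eulerOpR (hg : HasPowExpansion p μ c g) (j : Fin m) :
    HasPowExpansion p μ (fun n => (n j + μ j) * c n) (eulerOpR m j g) := by
  refine ⟨by simpa only [add_mul] using (hg.1.natCast_mul j).add (hg.1.const_mul (μ j)),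
    fun x hx => ?_⟩
  obtain ⟨L, hL, hLj⟩ := hg.1.hasFDerivAt_tsum hx
  have hG := ((hasFDerivAt_cpowMonomial μ hx.1).mul hL).congr_of_eventuallyEq
    (Filter.eventuallyEq_of_mem ((isOpen_lauricellaRegion p m).mem_nhds hx) hg.2)
  have hxj : (x j : ℂ) ≠ 0 := Complex.ofReal_ne_zero.2 (hx.1 j).ne'
  simp only [_root_.eulerOpR, hG.fderiv, add_apply,
    smul_apply, cpowMonomialLogDeriv_single, smul_eq_mul]
  simp only [add_mul]
  rw [((hg.1.natCast_mul j).summable hx).tsum_add ((hg.1.const_mul (μ j)).summable hx), ← hLj]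
  simp only [mul_assoc]
  rw [tsum_mul_left]
  field_simp

lemma eulerSumR (hg : HasPowExpansion p μ c g) :
    HasPowExpansion p μ (fun n => (∑ k, (n k + μ k)) * c n) (eulerSumR m g) := by
  simp only [Finset.sum_mul]
  exact sum Finset.univ fun j => hg.eulerOpR j

lemma foldr_opAddConstR {T : ((Fin m → ℝ) → ℂ) → ((Fin m → ℝ) → ℂ)} {w : (Fin m → ℕ) → ℂ}
    (hT : ∀ {c g}, HasPowExpansion p μ c g → HasPowExpansion p μ (fun n => w n * c n) (T g))
    (hg : HasPowExpansion p μ c g) {q : ℕ} (z : Fin q → ℂ) :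
    HasPowExpansion p μ (fun n => (∏ i, (w n + z i)) * c n)
      (((List.ofFn fun i => opAddConstR m T (z i)).foldr (· ∘ ·) id) g) := by
  induction q with
  | zero => simpa using hg
  | succ q ih =>
    have h := ih fun i => z i.succ
    simp only [List.ofFn_succ, List.foldr_cons, Function.comp_apply, Fin.prod_univ_succ]
    simp only [mul_assoc, add_mul]
    exact (hT h).add (h.const_mul _)

end HasPowExpansion

lemma exists_le_const_mul_pow {u v : ℕ → ℝ} (hu : ∀ n, 0 ≤ u n)
    (huv : ∀ n, u (n + 1) = v n * u n) (hv : Filter.Tendsto v Filter.atTop (nhds 1))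
    {ρ : ℝ} (hρ : 1 < ρ) : ∃ C, ∀ n, u n ≤ C * ρ ^ n := by
  obtain ⟨N, hN⟩ := Filter.eventually_atTop.1 (hv.eventually (ge_mem_nhds hρ))
  have hC : 0 ≤ ∑ i ∈ Finset.range (N + 1), u i := Finset.sum_nonneg fun i _ => hu i
  have hsmall : ∀ n ≤ N, u n ≤ (∑ i ∈ Finset.range (N + 1), u i) * ρ ^ n := fun n hn =>
    (Finset.single_le_sum (fun i _ => hu i)
      (Finset.mem_range.2 (Nat.lt_succ_of_le hn))).trans
      (le_mul_of_one_le_right hC (one_le_pow₀ hρ.le))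
  refine ⟨∑ i ∈ Finset.range (N + 1), u i, fun n => ?_⟩
  rcases le_total n N with hn | hn
  · exact hsmall n hn
  · induction n, hn using Nat.le_induction with
    | base => exact hsmall N le_rfl
    | succ n hn ih =>
      rw [huv, pow_succ']
      calc v n * u n ≤ ρ * ((∑ i ∈ Finset.range (N + 1), u i) * ρ ^ n) :=
            mul_le_mul (hN n hn) ih (hu n) (zero_le_one.trans hρ.le)
        _ = _ := by ring

lemma tendsto_norm_add_natCast_div (z : ℂ) :
    Filter.Tendsto (fun n : ℕ => ‖z + n‖ / ((n : ℝ) + 1)) Filter.atTop (nhds 1) := by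
  have h1 : Filter.Tendsto (fun n : ℕ => (1 : ℂ) + (z - 1) * (1 / ((n : ℂ) + 1)))
      Filter.atTop (nhds (1 + (z - 1) * 0)) :=
    (tendsto_one_div_add_atTop_nhds_zero_nat (𝕜 := ℂ)).const_mul (z - 1) |>.const_add 1
  have h2 := h1.norm
  simp only [mul_zero, add_zero, norm_one] at h2
  refine h2.congr fun n => ?_
  have hn : (n : ℂ) + 1 ≠ 0 := Nat.cast_add_one_ne_zero n
  have hnorm : ‖(n : ℂ) + 1‖ = (n : ℝ) + 1 := by
    exact_mod_cast Complex.norm_natCast (n + 1)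
  rw [← hnorm, ← norm_div]
  congr 1
  field_simp
  ring

lemma exists_norm_ascPochhammer_div_factorial_le (z : ℂ) {ρ : ℝ} (hρ : 1 < ρ) :
    ∃ C, ∀ n : ℕ, ‖(ascPochhammer ℂ n).eval z‖ / n.factorial ≤ C * ρ ^ n := by
  refine exists_le_const_mul_pow (fun n => by positivity) (fun n => ?_)
    (tendsto_norm_add_natCast_div z) hρ
  rw [ascPochhammer_succ_eval, norm_mul, Nat.factorial_succ, mul_comm, Nat.cast_mul, mul_div_mul_comm]
  push_cast
  rfl

lemma exists_factorial_div_norm_ascPochhammer_le (z : ℂ) {ρ : ℝ} (hρ : 1 < ρ) :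
    ∃ C, ∀ n : ℕ, n.factorial / ‖(ascPochhammer ℂ n).eval z‖ ≤ C * ρ ^ n := by
  have hv := (tendsto_norm_add_natCast_div z).inv₀ one_ne_zero
  simp only [inv_div, inv_one] at hv
  refine exists_le_const_mul_pow (fun n => by positivity) (fun n => ?_) hv hρ
  rw [ascPochhammer_succ_eval, norm_mul, Nat.factorial_succ, mul_comm ‖_‖, Nat.cast_mul, mul_div_mul_comm]
  push_cast
  rfl

lemma summable_multinomial_pow {m p : ℕ} (hp : p ≠ 0) {z : Fin m → ℝ} (hz : ∀ k, 0 ≤ z k)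
    (hz1 : ∑ k, z k < 1) :
    Summable fun n : Fin m → ℕ =>
      ((Nat.multinomial Finset.univ n : ℝ) * ∏ k, z k ^ n k) ^ p := by
  have h0 : ∀ n : Fin m → ℕ, 0 ≤ (Nat.multinomial Finset.univ n : ℝ) * ∏ k, z k ^ n k :=
    fun n => mul_nonneg (Nat.cast_nonneg _) (Finset.prod_nonneg fun k _ => pow_nonneg (hz k) _)
  have hs0 : 0 ≤ ∑ k, z k := Finset.sum_nonneg fun k _ => hz k
  have hfib : ∀ N, ∑ n ∈ Finset.univ.piAntidiag N,
      (Nat.multinomial Finset.univ n : ℝ) * ∏ k, z k ^ n k = (∑ k, z k) ^ N := fun N =>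
    (Finset.sum_pow_eq_sum_piAntidiag Finset.univ z N).symm
  have hle1 : ∀ n : Fin m → ℕ,
      (Nat.multinomial Finset.univ n : ℝ) * ∏ k, z k ^ n k ≤ 1 := fun n =>
    calc _ ≤ ∑ n' ∈ Finset.univ.piAntidiag (∑ k, n k),
          (Nat.multinomial Finset.univ n' : ℝ) * ∏ k, z k ^ n' k :=
          Finset.single_le_sum (fun n' _ => h0 n') (by simp)
      _ = (∑ k, z k) ^ ∑ k, n k := hfib _
      _ ≤ 1 := pow_le_one₀ hs0 hz1.le
  have hsum : Summable fun n : Fin m → ℕ =>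
      (Nat.multinomial Finset.univ n : ℝ) * ∏ k, z k ^ n k := by
    refine summable_of_sum_le (c := ∑' N, (∑ k, z k) ^ N) h0 fun s => ?_
    rw [← Finset.sum_fiberwise_of_maps_to
      (fun n hn => Finset.mem_image_of_mem (fun n : Fin m → ℕ => ∑ k, n k) hn)]
    refine (Finset.sum_le_sum fun N _ => ?_).trans
      ((summable_geometric_of_lt_one hs0 hz1).sum_le_tsum
        (s.image fun n : Fin m → ℕ => ∑ k, n k) fun N _ => pow_nonneg hs0 N)
    rw [← hfib N]
    refine Finset.sum_le_sum_of_subset_of_nonneg (fun n hn => ?_) fun n _ _ => h0 n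
    simpa using (Finset.mem_filter.1 hn).2
  exact Summable.of_nonneg_of_le (fun n => pow_nonneg (h0 n) p)
    (fun n => pow_le_of_le_one (h0 n) (hle1 n) hp) hsum

/-- The coefficients of the Lauricella-type series with numerator parameters `α` and denominator
parameters `β`. -/
noncomputable def lauricellaCoeff {p m q : ℕ} (α : Fin p → ℂ) (β : Fin q → Fin m → ℂ)
    (n : Fin m → ℕ) : ℂ :=
  (∏ i, (ascPochhammer ℂ (∑ k, n k)).eval (α i)) /
    (∏ k, ((∏ j, (ascPochhammer ℂ (n k)).eval (β j k)) * (Nat.factorial (n k) : ℂ)))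

lemma norm_lauricellaCoeff {q m : ℕ} (α : Fin (q + 1) → ℂ) (β : Fin q → Fin m → ℂ)
    (n : Fin m → ℕ) :
    ‖lauricellaCoeff α β n‖ =
      (∏ i, ‖(ascPochhammer ℂ (∑ k, n k)).eval (α i)‖ / (∑ k, n k).factorial) *
      (∏ k, ∏ j, ((n k).factorial : ℝ) / ‖(ascPochhammer ℂ (n k)).eval (β j k)‖) *
      (Nat.multinomial Finset.univ n : ℝ) ^ (q + 1) := by
  have hP : (∏ k, ((n k).factorial : ℝ)) ≠ 0 :=
    Finset.prod_ne_zero_iff.2 fun k _ => Nat.cast_ne_zero.2 (Nat.factorial_ne_zero _)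
  have hN : ((∑ k, n k).factorial : ℝ) ≠ 0 := Nat.cast_ne_zero.2 (Nat.factorial_ne_zero _)
  have hmult : (Nat.multinomial Finset.univ n : ℝ) =
      (∑ k, n k).factorial / ∏ k, ((n k).factorial : ℝ) := by
    rw [eq_div_iff hP, mul_comm]
    exact_mod_cast Nat.multinomial_spec Finset.univ n
  rw [hmult, lauricellaCoeff]
  simp only [norm_div, norm_prod, norm_mul, Complex.norm_natCast, Finset.prod_div_distrib,
    Finset.prod_mul_distrib, Finset.prod_const, Finset.card_univ, Fintype.card_fin,
    Finset.prod_pow]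
  rw [div_pow]
  by_cases hD : (∏ k, ∏ j, ‖(ascPochhammer ℂ (n k)).eval (β j k)‖) = 0
  · simp [hD]
  · field_simp
    ring

lemma absConvergent_lauricellaCoeff {q m : ℕ} (α : Fin (q + 1) → ℂ) (β : Fin q → Fin m → ℂ) :
    AbsConvergent (q + 1) (lauricellaCoeff α β) := by
  intro x hx
  obtain ⟨t, ht, htx⟩ := exists_one_lt_mul_mem_lauricellaRegion hx
  have ht0 : 0 < t := zero_lt_one.trans ht
  obtain ⟨ρ, hρ, hρt⟩ : ∃ ρ : ℝ, 1 < ρ ∧ ρ ^ (2 * q + 1) = t :=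
    ⟨t ^ (((2 * q + 1 : ℕ) : ℝ)⁻¹), Real.one_lt_rpow ht (by positivity),
      Real.rpow_inv_natCast_pow ht0.le (Nat.succ_ne_zero _)⟩
  choose C hC using fun i => exists_norm_ascPochhammer_div_factorial_le (α i) hρ
  choose D hD using fun (k : Fin m) j => exists_factorial_div_norm_ascPochhammer_le (β j k) hρ
  have hsum := (summable_multinomial_pow (Nat.succ_ne_zero q)
    (fun k => Real.rpow_nonneg (htx.1 k).le (((q + 1 : ℕ) : ℝ)⁻¹)) htx.2).mul_left
    ((∏ i, C i) * ∏ k, ∏ j, D k j)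
  have hp : ∀ n : Fin m → ℕ, 0 ≤ ∏ k, x k ^ n k := fun n =>
    Finset.prod_nonneg fun k _ => pow_nonneg (hx.1 k).le _
  refine Summable.of_nonneg_of_le (fun n => mul_nonneg (norm_nonneg _) (hp n)) (fun n => ?_) hsum
  have hz : (∏ k, ((t * x k) ^ (((q + 1 : ℕ) : ℝ)⁻¹)) ^ n k) ^ (q + 1) =
      t ^ (∑ k, n k) * ∏ k, x k ^ n k := by
    rw [← Finset.prod_pow_eq_pow_sum, ← Finset.prod_mul_distrib, ← Finset.prod_pow]
    refine Finset.prod_congr rfl fun k _ => ?_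
    rw [pow_right_comm, Real.rpow_inv_natCast_pow (htx.1 k).le (Nat.succ_ne_zero q), mul_pow]
  rw [norm_lauricellaCoeff, mul_pow, hz]
  calc _ ≤ (∏ i, C i * ρ ^ (∑ k, n k)) * (∏ k, ∏ j, D k j * ρ ^ n k) *
        (Nat.multinomial Finset.univ n : ℝ) ^ (q + 1) * ∏ k, x k ^ n k := by
        refine mul_le_mul_of_nonneg_right (mul_le_mul_of_nonneg_right ?_ (by positivity)) (hp n)
        refine mul_le_mul (Finset.prod_le_prod (fun i _ => by positivity) fun i _ => hC i _)
          (Finset.prod_le_prod (fun k _ => by positivity) fun k _ =>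
            Finset.prod_le_prod (fun j _ => by positivity) fun j _ => hD k j _)
          (by positivity)
          (Finset.prod_nonneg fun i _ => le_trans (by positivity) (hC i (∑ k, n k)))
    _ = _ := by
        simp only [Finset.prod_mul_distrib, Finset.prod_const, Finset.card_univ,
          Fintype.card_fin, Finset.prod_pow, Finset.prod_pow_eq_pow_sum]
        rw [← hρt, Nat.succ_eq_add_one]
        ring

/-- The contiguity relation between the coefficients at `n` and at `n + e_k`. -/
lemma lauricellaCoeff_add_single {p q m : ℕ} (α : Fin p → ℂ) (β : Fin q → Fin m → ℂ)
    (n : Fin m → ℕ) (k : Fin m) (hβ : ∀ j, β j k + n k ≠ 0) :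
    (n k + 1) * (∏ j, (β j k + n k)) * lauricellaCoeff α β (n + Pi.single k 1) =
      (∏ i, (α i + (∑ l, n l : ℕ))) * lauricellaCoeff α β n := by
  have hsum : ∑ l, (n + Pi.single k 1 : Fin m → ℕ) l = ∑ l, n l + 1 := by
    simp [Finset.sum_add_distrib]
  have hden : ∀ F : Fin m → ℕ → ℂ, ∏ l, F l ((n + Pi.single k 1 : Fin m → ℕ) l) =
      F k (n k + 1) * ∏ l ∈ Finset.univ.erase k, F l (n l) := by
    intro F
    rw [← Finset.mul_prod_erase _ _ (Finset.mem_univ k)]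
    congr 1
    · simp
    · refine Finset.prod_congr rfl fun l hl => ?_
      simp [Pi.single_eq_of_ne (Finset.ne_of_mem_erase hl)]
  have hk : ∏ j, (β j k + n k) ≠ 0 := Finset.prod_ne_zero_iff.2 fun j _ => hβ j
  have hn : (n k : ℂ) + 1 ≠ 0 := Nat.cast_add_one_ne_zero _
  rw [lauricellaCoeff, lauricellaCoeff, hsum,
    hden fun l r => (∏ j, (ascPochhammer ℂ r).eval (β j l)) * (r.factorial : ℂ),
    ← Finset.mul_prod_erase Finset.univ
      (fun l => (∏ j, (ascPochhammer ℂ (n l)).eval (β j l)) * ((n l).factorial : ℂ))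
      (Finset.mem_univ k)]
  simp only [ascPochhammer_succ_eval, Finset.prod_mul_distrib, Nat.factorial_succ, Nat.cast_mul,
    Nat.cast_add, Nat.cast_one]
  rw [← mul_div_assoc, ← mul_div_assoc]
  refine Eq.trans ?_ (mul_div_mul_left _ _ (mul_ne_zero hn hk))
  congr 1 <;> ring

lemma tsum_monomial_eq_mul_tsum {m : ℕ} {c d : (Fin m → ℕ) → ℂ} (k : Fin m)
    (h0 : ∀ n, n k = 0 → c n = 0) (hs : ∀ n, c (n + Pi.single k 1) = d n) (x : Fin m → ℂ) :
    ∑' n : Fin m → ℕ, c n * ∏ l, x l ^ n l = x k * ∑' n : Fin m → ℕ, d n * ∏ l, x l ^ n l := by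
  have hinj : Function.Injective fun n : Fin m → ℕ => n + Pi.single k 1 :=
    add_left_injective _
  rw [← hinj.tsum_eq, ← tsum_mul_left]
  · refine tsum_congr fun n => ?_
    simp only [hs, Pi.add_apply, pow_add, Finset.prod_mul_distrib, Pi.single_apply, pow_ite,
      pow_one, pow_zero, Finset.prod_ite_eq', Finset.mem_univ, if_true]
    ring
  · intro n hn
    refine ⟨n - Pi.single k 1, tsub_add_cancel_of_le fun l => ?_⟩
    rcases eq_or_ne l k with rfl | hl
    · rw [Pi.single_eq_same, Nat.one_le_iff_ne_zero]
      intro h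
      exact hn (by simp [h0 n h])
    · simp [Pi.single_eq_of_ne hl]

/-- The indicial identity: shifting the exponents by `1 - b_i` permutes the roots of the
indicial polynomial. -/
lemma indicial_prod_eq {q : ℕ} {b β : Fin (q + 1) → ℂ} (hlast : b (Fin.last q) = 1)
    (i : Fin (q + 1))
    (hβ : ∀ j, β j = b j + (1 - b i) *
      (1 + (if j = i then (1 : ℂ) else 0) - (if j = Fin.last q then (1 : ℂ) else 0))) (s : ℂ) :
    (s + (1 - b i)) * ∏ j : Fin q, (s + (1 - b i) + (b j.castSucc - 1)) =
      s * ∏ j : Fin q, (β j.castSucc + (s - 1)) := by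
  have hβ' : ∀ j : Fin q, β j.castSucc = b j.castSucc + (1 - b i) *
      (1 + if j.castSucc = i then (1 : ℂ) else 0) := fun j => by
    rw [hβ, if_neg j.castSucc_ne_last, sub_zero]
  simp only [hβ']
  induction i using Fin.lastCases with
  | last =>
    rw [hlast]
    congr 1
    · ring
    · exact Finset.prod_congr rfl fun j _ => by ring
  | cast i =>
    rw [← Finset.mul_prod_erase _ _ (Finset.mem_univ i),
      ← Finset.mul_prod_erase Finset.univ (fun j : Fin q => _ + (s - 1)) (Finset.mem_univ i),
      if_pos rfl, ← mul_assoc, ← mul_assoc]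
    congr 1
    · ring
    · refine Finset.prod_congr rfl fun j hj => ?_
      rw [if_neg fun h => Finset.ne_of_mem_erase hj (Fin.castSucc_injective _ h)]
      ring

lemma shifted_param_add_natCast_ne_zero {q : ℕ} {b β : Fin (q + 1) → ℂ}
    (hlast : b (Fin.last q) = 1) (hb : ∀ j j', j < j' → ∀ z : ℤ, b j - b j' ≠ z)
    (i : Fin (q + 1))
    (hβ : ∀ j, β j = b j + (1 - b i) *
      (1 + (if j = i then (1 : ℂ) else 0) - (if j = Fin.last q then (1 : ℂ) else 0)))
    (j : Fin q) (n : ℕ) : β j.castSucc + n ≠ 0 := by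
  intro h
  rw [hβ, if_neg j.castSucc_ne_last] at h
  rcases lt_trichotomy j.castSucc i with hji | rfl | hji
  · rw [if_neg hji.ne] at h
    refine hb _ _ hji (-(n + 1)) ?_
    push_cast
    linear_combination h
  · rw [if_pos rfl] at h
    refine hb _ _ (Fin.castSucc_lt_last j) (n + 1) ?_
    rw [hlast]
    push_cast
    linear_combination -h
  · rw [if_neg hji.ne'] at h
    refine hb _ _ hji (n + 1) ?_
    push_cast
    linear_combination -h

/-- each function
`Φ_J(x) = (∏_k x_k^{μ_{J,k}}) · F_C^{p,m}(a + Σ_J 1, η_{j_1}(b_1),…,η_{j_m}(b_m); x)`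
is a solution of the hypergeometric system `𝓕_C^{p,m}(a,B)` on
`U = {x ∈ ℝ^m : 0 < x_k, x_1^{1/p} + ⋯ + x_m^{1/p} < 1}`. -/
theorem FCpm_PhiJ_solution (p m : ℕ) (hp : 2 ≤ p) (hm : 1 ≤ m)
    (a : Fin p → ℂ) (b : Fin p → Fin m → ℂ)
    (hblast : ∀ k : Fin m, b ⟨p - 1, by omega⟩ k = 1)
    -- condition (i): aᵢ − Σ_k b_{j_k,k} ∉ ℤ
    (hcond1 : ∀ (i : Fin p) (J : Fin m → Fin p) (z : ℤ),
      a i - ∑ k, b (J k) k ≠ (z : ℂ))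
    -- condition (ii): b_{j,k} − b_{j',k} ∉ ℤ for j < j'
    (hcond2 : ∀ (j j' : Fin p), j < j' → ∀ (k : Fin m) (z : ℤ),
      b j k - b j' k ≠ (z : ℂ))
    (J : Fin m → Fin p)
    (μ : Fin m → ℂ) (hμ : ∀ k, μ k = 1 - b (J k) k)
    (a' : Fin p → ℂ) (ha' : ∀ i, a' i = a i + ∑ k, μ k)
    (b' : Fin p → Fin m → ℂ)
    (hb' : ∀ (j : Fin p) (k : Fin m),
      b' j k = b j k + (1 - b (J k) k) *
        (1 + (if j = J k then (1 : ℂ) else 0) -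
          (if j = (⟨p - 1, by omega⟩ : Fin p) then (1 : ℂ) else 0)))
    (A' : (Fin m → ℕ) → ℂ)
    (hA' : ∀ n : Fin m → ℕ,
      A' n = (∏ i, (ascPochhammer ℂ (∑ k, n k)).eval (a' i)) /
        (∏ k, ((∏ j : Fin (p - 1),
            (ascPochhammer ℂ (n k)).eval (b' (Fin.castLE (by omega) j) k)) *
          (Nat.factorial (n k) : ℂ))))
    (Φ : (Fin m → ℝ) → ℂ)
    (hΦ : ∀ x : Fin m → ℝ,
      Φ x = (∏ k, Complex.exp (μ k * (Real.log (x k) : ℂ))) *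
        ∑' n : Fin m → ℕ, A' n * ∏ k, (x k : ℂ) ^ n k)
    (k : Fin m) (x : Fin m → ℝ)
    (hxpos : ∀ j, 0 < x j)
    (hx : ∑ j, x j ^ ((p : ℝ)⁻¹) < 1) :
    eulerOpR m k
      (((List.ofFn fun j : Fin (p - 1) =>
          opAddConstR m (eulerOpR m k) (b (Fin.castLE (by omega) j) k - 1)).foldr
        (· ∘ ·) id) Φ) x =
    (x k : ℂ) *
      (((List.ofFn fun i : Fin p =>
          opAddConstR m (eulerSumR m) (a i)).foldr (· ∘ ·) id) Φ) x := by
  obtain ⟨q, rfl⟩ : ∃ q, p = q + 1 := ⟨p - 1, by omega⟩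
  have hx' : x ∈ lauricellaRegion (q + 1) m := ⟨hxpos, hx⟩
  let β : Fin q → Fin m → ℂ := fun j => b' j.castSucc
  have hA : A' = lauricellaCoeff a' β := funext hA'
  have hΦ' : HasPowExpansion (q + 1) μ A' Φ :=
    ⟨hA ▸ absConvergent_lauricellaCoeff a' β, fun y _ => hΦ y⟩
  have hL := (hΦ'.foldr_opAddConstR (fun h => h.eulerOpR k)
    fun j : Fin q => b j.castSucc k - 1).eulerOpR k
  have hR := hΦ'.foldr_opAddConstR (fun h => h.eulerSumR) a
  have hprod := indicial_prod_eq (b := fun j => b j k) (β := fun j => b' j k) (hblast k) (J k)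
    fun j => hb' j k
  have hβ : ∀ (j : Fin q) (n : ℕ), β j k + n ≠ 0 :=
    shifted_param_add_natCast_ne_zero (b := fun j => b j k) (β := fun j => b' j k) (hblast k)
      (fun j j' hj => hcond2 j j' hj k) (J k) fun j => hb' j k
  refine (hL.2 x hx').trans ?_
  rw [hR.2 x hx', mul_left_comm, tsum_monomial_eq_mul_tsum k (fun n hn => ?_) fun n => ?_]
  · rw [← mul_assoc, hμ, hprod, hn]
    simp
  · have hrec := lauricellaCoeff_add_single a' β n k fun j => hβ j (n k)
    rw [← mul_assoc, hμ, hprod, hA]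
    have hnum : ∏ i, (∑ l, ((n l : ℂ) + μ l) + a i) = ∏ i, (a' i + (∑ l, n l : ℕ)) := by
      refine Finset.prod_congr rfl fun i _ => ?_
      rw [ha', Finset.sum_add_distrib]
      push_cast
      ring
    rw [hnum, ← hrec]
    simp [β]
end

section
/- Let p ≥ 2 and m ≥ 1 be integers, let a_1,…,a_p ∈ ℂ, and let b_{j,k} ∈ ℂ for 1 ≤ j ≤ p, 1 ≤ k ≤ m with b_{p,k} = 1 for all k. Assume (i) a_i − Σ_{k=1}^m b_{j_k,k} ∉ ℤ for every 1 ≤ i ≤ p and every J ∈ {1,…,p}^m, and (ii) b_{j,k} − b_{j',k} ∉ ℤ for all 1 ≤ j < j' ≤ p and all k. For J = (j_1,…,j_m) ∈ {1,…,p}^m define Φ_J on U_δ = (0,δ)^m (for any fixed δ with 0 < δ < m^{−p}) by Φ_J(x) = (∏_{k=1}^m exp(μ_{J,k}·log x_k)) · Σ_{n∈ℕ^m} A'_{J,n} x_1^{n_1}⋯x_m^{n_m}, where μ_{J,k} = 1 − b_{j_k,k}, Σ_J = Σ_k μ_{J,k}, a'_i = a_i + Σ_J, b'_{j,k} = b_{j,k}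 + (1 − b_{j_k,k})·(1 + δ_{j,j_k} − δ_{j,p}), and A'_{J,n} = (∏_{i=1}^p (a'_i)_{|n|}) / (∏_{k=1}^m (b'_{1,k})_{n_k}⋯(b'_{p−1,k})_{n_k}·n_k!). Then the p^m functions {Φ_J : J ∈ {1,…,p}^m} are linearly independent over ℂ in the space of functions U_δ → ℂ. -/
open scoped BigOperators

open Filter Topology in
/-- If a linear combination of geometric sequences with distinct ratios, each perturbed by a factor
tending to `1`, vanishes identically, then all coefficients vanish. -/
theorem eq_zero_of_sum_mul_pow_mul_eq_zero {ι : Type*} [Fintype ι] {z : ι → ℂ}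
    (hz : Function.Injective z) (hz0 : ∀ i, z i ≠ 0) {c : ι → ℂ} {g : ι → ℕ → ℂ}
    (hg : ∀ i, Tendsto (g i) atTop (𝓝 1))
    (h : ∀ᶠ n in atTop, ∑ i, c i * z i ^ n * g i n = 0) : c = 0 := by
  classical
  by_contra hc
  obtain ⟨j, hj⟩ := Function.ne_iff.mp hc
  obtain ⟨i₀, hi₀, hmax⟩ := (Finset.univ.filter fun i => c i ≠ 0).exists_max_image
    (fun i => ‖z i‖) ⟨j, by simpa using hj⟩
  simp only [Finset.mem_filter, Finset.mem_univ, true_and] at hi₀ hmax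
  set w : ι → ℂ := fun i => z i / z i₀ with hw
  have hw1 : ∀ i, c i ≠ 0 → ‖w i‖ ≤ 1 := fun i hi => by
    rw [hw, norm_div]
    exact div_le_one_of_le₀ (hmax i hi) (norm_nonneg _)
  have hterm : ∀ i, Tendsto (fun n => c i * w i ^ n * (1 - g i n)) atTop (𝓝 0) := fun i => by
    have h1 : Tendsto (fun n => ‖c i‖ * ‖1 - g i n‖) atTop (𝓝 0) := by
      simpa using (((hg i).const_sub 1).norm.const_mul ‖c i‖)
    refine squeeze_zero_norm (fun n => ?_) h1
    by_cases hi : c i = 0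
    · simp [hi]
    · rw [norm_mul, norm_mul, norm_pow]
      gcongr
      exact mul_le_of_le_one_right (norm_nonneg _) (pow_le_one₀ (norm_nonneg _) (hw1 i hi))
  have hS : Tendsto (fun n => ∑ i, c i * w i ^ n) atTop (𝓝 0) := by
    have h2 := tendsto_finsetSum Finset.univ fun i _ => hterm i
    rw [Finset.sum_const_zero] at h2
    refine h2.congr' ?_
    filter_upwards [h] with n hn
    have h3 : ∑ i, c i * w i ^ n * g i n = 0 := by
      have : ∀ i, c i * w i ^ n * g i n = (c i * z i ^ n * g i n) / z i₀ ^ n := fun i => by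
        rw [hw, div_pow]; ring
      rw [Finset.sum_congr rfl fun i _ => this i, ← Finset.sum_div, hn, zero_div]
    simp only [mul_sub, mul_one, Finset.sum_sub_distrib, h3, sub_zero]
  have hwinj : Function.Injective w := fun i i' hii' =>
    hz ((div_left_inj' (hz0 i₀)).mp hii')
  set P := Lagrange.basis Finset.univ w i₀ with hP
  have hPw : ∀ i, P.eval (w i) = if i = i₀ then 1 else 0 := fun i => by
    split_ifs with hi
    · rw [hi]
      exact Lagrange.eval_basis_self hwinj.injOn (Finset.mem_univ _)
    · exact Lagrange.eval_basis_of_ne (Ne.symm hi) (Finset.mem_univ _)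
  have hcomb : Tendsto (fun n => ∑ l ∈ Finset.range (P.natDegree + 1),
      P.coeff l * ∑ i, c i * w i ^ (n + l)) atTop (𝓝 0) := by
    have := tendsto_finsetSum (Finset.range (P.natDegree + 1)) fun l _ =>
      ((tendsto_add_atTop_iff_nat l).mpr hS).const_mul (P.coeff l)
    simpa using this
  have heq : ∀ n, ∑ l ∈ Finset.range (P.natDegree + 1),
      P.coeff l * ∑ i, c i * w i ^ (n + l) = c i₀ := fun n => by
    calc _ = ∑ i, c i * w i ^ n * P.eval (w i) := by
          simp_rw [Polynomial.eval_eq_sum_range, Finset.mul_sum]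
          rw [Finset.sum_comm]
          refine Finset.sum_congr rfl fun i _ => Finset.sum_congr rfl fun l _ => ?_
          rw [pow_add]; ring
      _ = c i₀ := by
          simp_rw [hPw]
          simp [hw, hz0 i₀]
  simp_rw [heq] at hcomb
  exact hi₀ (tendsto_nhds_unique tendsto_const_nhds hcomb)

open Filter Topology in
/-- Finitely many distinct complex vectors are separated by `μ ↦ exp (-∑ k, μ k * r k)` for a
suitable positive real vector `r`. -/
theorem exists_pos_injective_exp_neg_sum {ι : Type*} [Finite ι] {m : ℕ} {μ : ι → Fin m → ℂ}
    (hμ : Function.Injective μ) :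
    ∃ r : Fin m → ℝ, (∀ k, 0 < r k) ∧
      Function.Injective fun i => Complex.exp (-∑ k, μ i k * (r k : ℂ)) := by
  have h1 : ∀ᶠ s : ℕ in atTop, ∀ i j, i ≠ j → ∑ k, (μ i k - μ j k) * (s : ℂ) ^ (k : ℕ) ≠ 0 := by
    refine eventually_all.mpr fun i => eventually_all.mpr fun j =>
      eventually_imp_distrib_left.mpr fun hij => ?_
    set P : Polynomial ℂ := ∑ k : Fin m, Polynomial.C (μ i k - μ j k) * Polynomial.X ^ (k : ℕ)
      with hPdef
    have hP : P ≠ 0 := fun hP => by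
      refine hij (hμ (funext fun k => ?_))
      have := congrArg (fun Q => Q.coeff (k : ℕ)) hP
      simpa [-map_sub, hPdef, Polynomial.finsetSum_coeff, Polynomial.coeff_X_pow, Fin.val_inj,
        sub_eq_zero] using this
    have hfin : {x : ℂ | P.IsRoot x}.Finite := Polynomial.finite_setOfPred_isRoot hP
    rw [← Nat.cofinite_eq_atTop]
    refine ((hfin.preimage (Nat.cast_injective (R := ℂ)).injOn).eventually_cofinite_notMem).mono
      fun s hs => ?_
    simpa [hPdef, Polynomial.eval_finsetSum] using hs
  obtain ⟨s, hs, hs0⟩ := (h1.and (eventually_gt_atTop 0)).exists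
  have h2 : ∀ᶠ t : ℝ in 𝓝[>] 0, ∀ i j, i ≠ j →
      Complex.exp (t * ∑ k, (μ i k - μ j k) * (s : ℂ) ^ (k : ℕ)) ≠ 1 := by
    refine eventually_all.mpr fun i => eventually_all.mpr fun j =>
      eventually_imp_distrib_left.mpr fun hij => ?_
    set d := ∑ k, (μ i k - μ j k) * (s : ℂ) ^ (k : ℕ)
    have hd : HasDerivAt (fun t : ℝ => Complex.exp (t * d)) d 0 := by
      simpa using ((Complex.ofRealCLM.hasDerivAt (x := 0)).mul_const d).cexp
    exact (hd.eventually_ne (hs i j hij)).filter_mono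
      (nhdsWithin_mono _ fun x hx => ne_of_gt hx)
  obtain ⟨t, ht, ht0⟩ := (h2.and self_mem_nhdsWithin).exists
  have ht0 : 0 < t := ht0
  refine ⟨fun k => t * (s : ℝ) ^ (k : ℕ), fun k => by positivity, fun i j hij => ?_⟩
  by_contra hne
  refine ht i j hne ?_
  have : (t : ℂ) * ∑ k, (μ i k - μ j k) * (s : ℂ) ^ (k : ℕ) =
      -∑ k, μ j k * ((t * (s : ℝ) ^ (k : ℕ) : ℝ) : ℂ) -
        -∑ k, μ i k * ((t * (s : ℝ) ^ (k : ℕ) : ℝ) : ℂ) := by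
    push_cast
    rw [sub_neg_eq_add, neg_add_eq_sub, ← Finset.sum_sub_distrib, Finset.mul_sum]
    exact Finset.sum_congr rfl fun k _ => by ring
  rw [this, Complex.exp_sub]
  exact (div_eq_one_iff_eq (Complex.exp_ne_zero _)).mpr hij.symm

theorem summable_prod_pow {m : ℕ} {r : ℝ} (hr0 : 0 ≤ r) (hr1 : r < 1) :
    Summable fun n : Fin m → ℕ => ∏ k, r ^ n k := by
  induction m with
  | zero => exact .of_finite
  | succ m ih =>
    rw [← (Fin.consEquiv fun _ => ℕ).summable_iff]
    have := (summable_geometric_of_lt_one hr0 hr1).mul_of_nonneg ih (fun _ => by positivity)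
      (fun _ => Finset.prod_nonneg fun _ _ => by positivity)
    refine this.congr fun x => ?_
    simp [Fin.prod_univ_succ, Fin.consEquiv]

theorem norm_ascPochhammer_eval_le {a : ℂ} {K : ℝ} (hK : ‖a‖ + 1 ≤ K) (n : ℕ) :
    ‖(ascPochhammer ℂ n).eval a‖ ≤ K ^ n * n.factorial := by
  induction n with
  | zero => simp
  | succ n ih =>
    have hK0 : 0 ≤ K := by linarith [norm_nonneg a]
    rw [ascPochhammer_succ_eval, norm_mul]
    have h : ‖a + n‖ ≤ K * (n + 1) := by
      have := norm_add_le a (n : ℂ)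
      rw [Complex.norm_natCast] at this
      nlinarith [norm_nonneg a, (Nat.cast_nonneg n : (0 : ℝ) ≤ n)]
    calc _ ≤ (K ^ n * n.factorial) * (K * (n + 1)) := by gcongr
      _ = _ := by push_cast [Nat.factorial_succ]; ring

theorem le_norm_ascPochhammer_eval {b : ℂ} {ε : ℝ} (hε : 0 ≤ ε)
    (h : ∀ l : ℕ, ε * (l + 1) ≤ ‖b + l‖) (n : ℕ) :
    ε ^ n * n.factorial ≤ ‖(ascPochhammer ℂ n).eval b‖ := by
  induction n with
  | zero => simp
  | succ n ih =>
    rw [ascPochhammer_succ_eval, norm_mul]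
    calc _ = (ε ^ n * n.factorial) * (ε * (n + 1)) := by push_cast [Nat.factorial_succ]; ring
      _ ≤ _ := by gcongr; exact h n

open Filter Topology in
theorem eventually_mul_succ_le_norm_add {b : ℂ} (hb : ∀ l : ℕ, b + l ≠ 0) :
    ∀ᶠ ε : ℝ in 𝓝[>] 0, ∀ l : ℕ, ε * (l + 1) ≤ ‖b + l‖ := by
  obtain ⟨N, hN⟩ := exists_nat_ge (2 * ‖b‖ + 1)
  have hsmall : ∀ᶠ ε : ℝ in 𝓝[>] 0, ∀ l ∈ Finset.range N, ε * (l + 1) ≤ ‖b + l‖ := by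
    rw [Filter.eventually_all_finset]
    intro l _
    have : Tendsto (fun ε : ℝ => ε * (l + 1)) (𝓝[>] 0) (𝓝 0) := by
      have := (tendsto_id (α := ℝ) (x := 𝓝 0)).mul_const ((l : ℝ) + 1)
      rw [zero_mul] at this
      exact this.mono_left nhdsWithin_le_nhds
    exact (this.eventually_lt_const (norm_pos_iff.mpr (hb l))).mono fun _ => le_of_lt
  have hhalf : ∀ᶠ ε : ℝ in 𝓝[>] 0, ε < 1 / 2 :=
    (eventually_lt_nhds (by norm_num)).filter_mono nhdsWithin_le_nhds
  filter_upwards [hsmall, hhalf] with ε h1 h2 l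
  by_cases hl : l < N
  · exact h1 l (Finset.mem_range.mpr hl)
  · have hl' : (N : ℝ) ≤ l := by exact_mod_cast not_lt.mp hl
    have := norm_sub_le (b + l) b
    rw [add_sub_cancel_left, Complex.norm_natCast] at this
    nlinarith [(Nat.cast_nonneg l : (0 : ℝ) ≤ l)]

theorem factorial_sum_le_pow_mul_prod_factorial {m : ℕ} (n : Fin m → ℕ) :
    (∑ k, n k).factorial ≤ m ^ (∑ k, n k) * ∏ k, (n k).factorial := by
  have hle : Nat.multinomial Finset.univ n ≤ m ^ (∑ k, n k) := by
    have h := Finset.sum_pow_eq_sum_piAntidiag Finset.univ (fun _ : Fin m => 1) (∑ k, n k)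
    simp only [Finset.sum_const, Finset.card_univ, Fintype.card_fin, smul_eq_mul, mul_one,
      one_pow, Finset.prod_const_one, Nat.cast_id] at h
    rw [h]
    exact Finset.single_le_sum (f := fun k => Nat.multinomial Finset.univ k)
      (fun _ _ => Nat.zero_le _) (by simp)
  rw [← Nat.multinomial_spec Finset.univ n, mul_comm]
  gcongr

open Filter Topology in
/-- The coefficients of a Lauricella series of type `F_C` grow at most geometrically. -/
theorem exists_norm_coeff_le_pow {p q m : ℕ} (hpq : p = q + 1) (a : Fin p → ℂ)
    (b : Fin q → Fin m → ℂ) (hb : ∀ j k, ∀ l : ℕ, b j k + l ≠ 0) :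
    ∃ R : ℝ, 0 ≤ R ∧ ∀ n : Fin m → ℕ,
      ‖(∏ i, (ascPochhammer ℂ (∑ k, n k)).eval (a i)) /
        (∏ k, ((∏ j, (ascPochhammer ℂ (n k)).eval (b j k)) * ((n k).factorial : ℂ)))‖
        ≤ R ^ ∑ k, n k := by
  obtain ⟨ε, hε, hε0⟩ := ((eventually_all.mpr fun j => eventually_all.mpr fun k =>
    eventually_mul_succ_le_norm_add (hb j k)).and self_mem_nhdsWithin).exists
  have hε0 : 0 < ε := hε0
  set K : ℝ := ∑ i, ‖a i‖ + 1 with hKdef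
  have hK : ∀ i, ‖a i‖ + 1 ≤ K := fun i => by
    rw [hKdef]
    gcongr
    exact Finset.single_le_sum (f := fun i => ‖a i‖) (fun _ _ => norm_nonneg _)
      (Finset.mem_univ i)
  have hK0 : 0 ≤ K := by positivity
  refine ⟨(K * m) ^ p / ε ^ q, by positivity, fun n => ?_⟩
  set N := ∑ k, n k with hN
  set F : ℝ := ∏ k, ((n k).factorial : ℝ) with hF
  have hF0 : 0 < F := Finset.prod_pos fun k _ => by positivity
  have hnum : ‖∏ i, (ascPochhammer ℂ N).eval (a i)‖ ≤ ((K * m) ^ N * F) ^ p := by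
    rw [norm_prod]
    calc _ ≤ ∏ _i : Fin p, ((K * m) ^ N * F) := by
          refine Finset.prod_le_prod (fun _ _ => norm_nonneg _) fun i _ =>
            (norm_ascPochhammer_eval_le (hK i) N).trans ?_
          have : (N.factorial : ℝ) ≤ m ^ N * F := by
            rw [hF]
            exact_mod_cast factorial_sum_le_pow_mul_prod_factorial n
          rw [mul_pow, mul_assoc]
          gcongr
      _ = _ := by simp
  have hden : (ε ^ q) ^ N * F ^ p ≤
      ‖∏ k, ((∏ j, (ascPochhammer ℂ (n k)).eval (b j k)) * ((n k).factorial : ℂ))‖ := by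
    rw [norm_prod]
    calc _ = ∏ k, ((∏ _j : Fin q, (ε ^ n k * (n k).factorial)) * ((n k).factorial : ℝ)) := by
          simp only [Finset.prod_const, Finset.card_univ, Fintype.card_fin,
            Finset.prod_mul_distrib, mul_pow, Finset.prod_pow, hF, hpq, pow_succ, hN,
            Finset.prod_pow_eq_pow_sum, ← pow_mul, mul_comm q, mul_assoc, Finset.sum_mul]
      _ ≤ _ := by
          refine Finset.prod_le_prod (fun _ _ => by positivity) fun k _ => ?_
          rw [norm_mul, norm_prod, Complex.norm_natCast]
          gcongr with j
          exact le_norm_ascPochhammer_eval hε0.le (hε j k) (n k)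
  rw [norm_div]
  calc _ ≤ ((K * m) ^ N * F) ^ p / ((ε ^ q) ^ N * F ^ p) := by gcongr
    _ = _ := by
      rw [mul_pow, mul_div_mul_right _ _ (pow_pos hF0 p).ne', div_pow, ← pow_mul (K * m) N p,
        ← pow_mul (K * m) p N, mul_comm N p]

open Filter Topology in
/-- A power series with geometrically bounded coefficients tends to its constant term at `0`. -/
theorem tendsto_tsum_mul_prod_pow {m : ℕ} {A : (Fin m → ℕ) → ℂ} {R : ℝ} (hR : 0 ≤ R)
    (hA : ∀ n, ‖A n‖ ≤ R ^ ∑ k, n k) {α : Type*} {l : Filter α} {x : α → Fin m → ℂ}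
    (hx : Tendsto x l (𝓝 0)) :
    Tendsto (fun t => ∑' n : Fin m → ℕ, A n * ∏ k, x t k ^ n k) l (𝓝 (A 0)) := by
  have hsum : ∑' n : Fin m → ℕ, A n * ∏ k, (0 : Fin m → ℂ) k ^ n k = A 0 := by
    rw [tsum_eq_single 0]
    · simp
    · intro n hn
      obtain ⟨k, hk⟩ := Function.ne_iff.mp hn
      rw [Finset.prod_eq_zero (Finset.mem_univ k) (by simpa using hk), mul_zero]
  rw [← hsum]
  have hxk : ∀ k, Tendsto (fun t => x t k) l (𝓝 ((0 : Fin m → ℂ) k)) := tendsto_pi_nhds.mp hx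
  refine tendsto_tsum_of_dominated_convergence
    (summable_prod_pow (r := 1 / 2) (by norm_num) (by norm_num))
    (fun n => (tendsto_finsetProd _ fun k _ => (hxk k).pow (n k)).const_mul _) ?_
  have hsmall : ∀ᶠ t in l, ∀ k, R * ‖x t k‖ < 1 / 2 := by
    refine eventually_all.mpr fun k => ?_
    have : Tendsto (fun t => R * ‖x t k‖) l (𝓝 0) := by
      simpa using (hxk k).norm.const_mul R
    exact this.eventually_lt_const (by norm_num)
  filter_upwards [hsmall] with t ht n
  calc ‖A n * ∏ k, x t k ^ n k‖ ≤ R ^ (∑ k, n k) * ∏ k, ‖x t k‖ ^ n k := by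
        rw [norm_mul, norm_prod]
        simp only [norm_pow]
        gcongr
        exact hA n
    _ = ∏ k, (R * ‖x t k‖) ^ n k := by
        simp only [mul_pow, Finset.prod_mul_distrib, Finset.prod_pow_eq_pow_sum]
    _ ≤ ∏ k, (1 / 2 : ℝ) ^ n k := by
        gcongr with k
        exact (ht k).le

/-- under the non-integrality conditions, the `p^m` functions
`Φ_J(x) = (∏_k x_k^{μ_{J,k}}) · F_C^{p,m}(a + Σ_J 1, η_{j_1}(b_1),…,η_{j_m}(b_m); x)`,
`J ∈ {1,…,p}^m`, are linearly independent over `ℂ` as functions on `U_δ = (0,δ)^m`. -/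
theorem FCpm_PhiJ_linearIndependent (p m : ℕ) (hp : 2 ≤ p) (hm : 1 ≤ m)
    (a : Fin p → ℂ) (b : Fin p → Fin m → ℂ)
    (hblast : ∀ k : Fin m, b ⟨p - 1, by omega⟩ k = 1)
    -- condition (i): aᵢ − Σ_k b_{j_k,k} ∉ ℤ
    (hcond1 : ∀ (i : Fin p) (J : Fin m → Fin p) (z : ℤ),
      a i - ∑ k, b (J k) k ≠ (z : ℂ))
    -- condition (ii): b_{j,k} − b_{j',k} ∉ ℤ for j < j'
    (hcond2 : ∀ (j j' : Fin p), j < j' → ∀ (k : Fin m) (z : ℤ),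
      b j k - b j' k ≠ (z : ℂ))
    (δ : ℝ) (hδ0 : 0 < δ) (hδ : δ < (m : ℝ) ^ (-(p : ℤ)))
    (μ : (Fin m → Fin p) → Fin m → ℂ)
    (hμ : ∀ (J : Fin m → Fin p) (k : Fin m), μ J k = 1 - b (J k) k)
    (a' : (Fin m → Fin p) → Fin p → ℂ)
    (ha' : ∀ (J : Fin m → Fin p) (i : Fin p), a' J i = a i + ∑ k, μ J k)
    (b' : (Fin m → Fin p) → Fin p → Fin m → ℂ)
    (hb' : ∀ (J : Fin m → Fin p) (j : Fin p) (k : Fin m),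
      b' J j k = b j k + (1 - b (J k) k) *
        (1 + (if j = J k then (1 : ℂ) else 0) -
          (if j = (⟨p - 1, by omega⟩ : Fin p) then (1 : ℂ) else 0)))
    (A' : (Fin m → Fin p) → (Fin m → ℕ) → ℂ)
    (hA' : ∀ (J : Fin m → Fin p) (n : Fin m → ℕ),
      A' J n = (∏ i, (ascPochhammer ℂ (∑ k, n k)).eval (a' J i)) /
        (∏ k, ((∏ j : Fin (p - 1),
            (ascPochhammer ℂ (n k)).eval (b' J (Fin.castLE (by omega) j) k)) *
          (Nat.factorial (n k) : ℂ))))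
    (Φ : (Fin m → Fin p) → (Fin m → ℝ) → ℂ)
    (hΦ : ∀ (J : Fin m → Fin p) (x : Fin m → ℝ),
      Φ J x = (∏ k, Complex.exp (μ J k * (Real.log (x k) : ℂ))) *
        ∑' n : Fin m → ℕ, A' J n * ∏ k, (x k : ℂ) ^ n k) :
    LinearIndependent ℂ
      (fun J : Fin m → Fin p =>
        ({x : Fin m → ℝ | ∀ k, x k ∈ Set.Ioo (0 : ℝ) δ}).restrict (Φ J)) := by
  have hne : ∀ (j j' : Fin p), j ≠ j' → ∀ (k : Fin m) (z : ℤ), b j k - b j' k ≠ (z : ℂ) := by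
    intro j j' hjj' k z
    rcases lt_or_gt_of_ne hjj' with h | h
    · exact hcond2 j j' h k z
    · intro he
      exact hcond2 j' j h k (-z) (by push_cast; rw [← he]; ring)
  have hμinj : Function.Injective μ := fun J J' h => by
    funext k
    by_contra hk
    refine hne _ _ hk k 0 ?_
    have := congrFun h k
    rw [hμ, hμ] at this
    push_cast
    linear_combination -this
  have hb'0 : ∀ (J : Fin m → Fin p) (j : Fin (p - 1)) (k : Fin m) (l : ℕ),
      b' J (Fin.castLE (by omega) j) k + l ≠ 0 := by
    intro J j k l
    have hj : (Fin.castLE (by omega) j : Fin p) ≠ ⟨p - 1, by omega⟩ := by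
      intro h
      have := congrArg Fin.val h
      simp only [Fin.val_castLE] at this
      omega
    rw [hb', if_neg hj]
    by_cases hJ : (Fin.castLE (by omega) j : Fin p) = J k
    · rw [if_pos hJ, ← hJ]
      intro h
      refine hne _ _ hj k (1 + l) ?_
      rw [hblast]
      push_cast
      linear_combination -h
    · rw [if_neg hJ]
      intro h
      refine hne _ _ hJ k (-1 - l) ?_
      push_cast
      linear_combination h
  obtain ⟨r, hr0, hrinj⟩ := exists_pos_injective_exp_neg_sum hμinj
  set x : ℕ → Fin m → ℝ := fun t k => Real.exp (-(t * r k)) with hxdef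
  have hx : ∀ k, Filter.Tendsto (fun t => x t k) Filter.atTop (nhds 0) := fun k =>
    Real.tendsto_exp_neg_atTop_nhds_zero.comp
      (tendsto_natCast_atTop_atTop.atTop_mul_const (hr0 k))
  have hxC : Filter.Tendsto (fun t k => (x t k : ℂ)) Filter.atTop (nhds 0) :=
    tendsto_pi_nhds.mpr fun k => by
      simpa [Function.comp_def] using (Complex.continuous_ofReal.tendsto 0).comp (hx k)
  have hseries : ∀ J, Filter.Tendsto
      (fun t => ∑' n : Fin m → ℕ, A' J n * ∏ k, (x t k : ℂ) ^ n k) Filter.atTop (nhds 1) := by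
    intro J
    obtain ⟨R, hR, hA⟩ := exists_norm_coeff_le_pow (by omega : p = (p - 1) + 1) (a' J)
      (fun j k => b' J (Fin.castLE (by omega) j) k) (hb'0 J)
    have h0 : A' J 0 = 1 := by simp [hA']
    rw [← h0]
    exact tendsto_tsum_mul_prod_pow hR (fun n => by rw [hA']; exact hA n) hxC
  rw [Fintype.linearIndependent_iff]
  intro c hc
  refine congrFun (eq_zero_of_sum_mul_pow_mul_eq_zero hrinj (fun _ => Complex.exp_ne_zero _)
    hseries ?_)
  filter_upwards [Filter.eventually_all.mpr fun k => (hx k).eventually_lt_const hδ0] with t ht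
  have hmem : x t ∈ {x : Fin m → ℝ | ∀ k, x k ∈ Set.Ioo (0 : ℝ) δ} := by
    simp only [Set.mem_ofPred_eq]
    exact fun k => ⟨Real.exp_pos _, ht k⟩
  have hval : ∑ J, c J * Φ J (x t) = 0 := by
    have := congrFun hc ⟨x t, hmem⟩
    rw [Finset.sum_apply] at this
    exact this
  rw [← hval]
  refine Finset.sum_congr rfl fun J _ => ?_
  rw [hΦ, mul_assoc, ← Complex.exp_nat_mul, ← Complex.exp_sum]
  congr 3
  rw [mul_neg, Finset.mul_sum, ← Finset.sum_neg_distrib]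
  refine Finset.sum_congr rfl fun k _ => ?_
  rw [hxdef, Real.log_exp]
  push_cast
  ring
end

section
/- Let p ≥ 2 and m ≥ 1 be integers and ζ = exp(2π√−1/p). Let c = (c_1,…,c_m) ∈ ℂ^m satisfy c_1⋯c_m ≠ 0 and ∏_{(i_1,…,i_m)∈{0,…,p−1}^m}(1 − ζ^{i_1}c_1 − ⋯ − ζ^{i_m}c_m) ≠ 0. In the polynomial ring ℂ[ξ_1,…,ξ_m], set M_k = ξ_k^p − ξ_m^p for 1 ≤ k ≤ m−1 and M_m = ξ_m^p − (c_1ξ_1 + ⋯ + c_mξ_m)^p. Then M_1, …, M_{m−1}, M_m is a regular sequence in ℂ[ξ_1,…,ξ_m]. -/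
set_option synthInstance.maxHeartbeats 400000

open scoped BigOperators
open MvPolynomial

namespace MvPolynomial

variable {σ K : Type*} [Field K]

/-- The ideal generated by the differences `X i ^ p - X b ^ p` with `i ∈ S`. -/
noncomputable def powDiffIdeal (K : Type*) [Field K] (p : ℕ) (b : σ) (S : Finset σ) :
    Ideal (MvPolynomial σ K) :=
  Ideal.span ((fun i => X i ^ p - X b ^ p) '' (S : Set σ))

theorem powDiffIdeal_mono (p : ℕ) (b : σ) {S T : Finset σ} (h : S ⊆ T) :
    powDiffIdeal K p b S ≤ powDiffIdeal K p b T :=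
  Ideal.span_mono (Set.image_mono (Finset.coe_subset.mpr h))

theorem pow_sub_pow_mem_powDiffIdeal (p : ℕ) (b : σ) {S : Finset σ} {i : σ} (hi : i ∈ S) :
    (X i ^ p - X b ^ p : MvPolynomial σ K) ∈ powDiffIdeal K p b S :=
  Ideal.subset_span ⟨i, hi, rfl⟩

variable [DecidableEq σ]

/-- Substitution of `e i * X b` for the variables `X i` with `i ∈ S`. -/
noncomputable def substLine (b : σ) (S : Finset σ) (e : σ → K) :
    MvPolynomial σ K →ₐ[K] MvPolynomial σ K :=
  aeval fun i => if i ∈ S then C (e i) * X b else X i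

theorem substLine_X (b : σ) (S : Finset σ) (e : σ → K) (i : σ) :
    substLine b S e (X i) = if i ∈ S then C (e i) * X b else X i := by
  simp [substLine]

theorem substLine_X_of_mem {b : σ} {S : Finset σ} (e : σ → K) {i : σ} (hi : i ∈ S) :
    substLine b S e (X i) = C (e i) * X b := by
  simp [substLine_X, hi]

theorem substLine_X_of_notMem {b : σ} {S : Finset σ} (e : σ → K) {i : σ} (hi : i ∉ S) :
    substLine b S e (X i) = X i := by
  simp [substLine_X, hi]

theorem substLine_C (b : σ) (S : Finset σ) (e : σ → K) (x : K) :
    substLine b S e (C x) = C x :=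
  (substLine b S e).commutes x

theorem substLine_empty (b : σ) (e : σ → K) (f : MvPolynomial σ K) :
    substLine b ∅ e f = f := by
  simp [substLine]

theorem substLine_substLine_singleton {a b : σ} {S : Finset σ} (ha : a ∉ S) (hbS : b ∉ S)
    (e : σ → K) (x : K) (f : MvPolynomial σ K) :
    substLine b S e (substLine b {a} (fun _ => x) f) =
      substLine b (insert a S) (Function.update e a x) f := by
  suffices h : (substLine b S e).comp (substLine b {a} fun _ => x) =
      substLine b (insert a S) (Function.update e a x) from DFunLike.congr_fun h f
  ext1 i
  rcases eq_or_ne i a with rfl | hi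
  · simp [substLine_X, hbS]
  · simp [substLine_X, hi]

theorem substLine_eq_zero_of_mem_powDiffIdeal {p : ℕ} {b : σ} {S : Finset σ} (hb : b ∉ S)
    {e : σ → K} (he : ∀ i, e i ^ p = 1) {f : MvPolynomial σ K}
    (hf : f ∈ powDiffIdeal K p b S) : substLine b S e f = 0 := by
  suffices h : powDiffIdeal K p b S ≤ RingHom.ker (substLine b S e) from h hf
  refine Ideal.span_le.mpr ?_
  rintro _ ⟨i, hi, rfl⟩
  rw [SetLike.mem_coe, RingHom.mem_ker, map_sub, map_pow, map_pow,
    substLine_X_of_mem e (Finset.mem_coe.mp hi), substLine_X_of_notMem e hb, mul_pow, ← C_pow, he,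
    C_1, one_mul, sub_self]

theorem substLine_singleton_mem_powDiffIdeal {p : ℕ} {a b : σ} {S : Finset σ} (ha : a ∉ S)
    (hab : b ≠ a) (x : K) {f : MvPolynomial σ K} (hf : f ∈ powDiffIdeal K p b S) :
    substLine b {a} (fun _ => x) f ∈ powDiffIdeal K p b S := by
  suffices h : powDiffIdeal K p b S ≤
      (powDiffIdeal K p b S).comap (substLine b {a} fun _ => x) from h hf
  refine Ideal.span_le.mpr ?_
  rintro _ ⟨i, hi, rfl⟩
  have hia : i ≠ a := fun h => ha (h ▸ Finset.mem_coe.mp hi)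
  rw [SetLike.mem_coe, Ideal.mem_comap, map_sub, map_pow, map_pow,
    substLine_X_of_notMem _ (by simpa using hia), substLine_X_of_notMem _ (by simpa using hab)]
  exact pow_sub_pow_mem_powDiffIdeal p b hi

theorem X_sub_dvd_sub_substLine_singleton (a b : σ) (x : K) (f : MvPolynomial σ K) :
    X a - C x * X b ∣ f - substLine b {a} (fun _ => x) f := by
  rw [← Ideal.mem_span_singleton, ← Ideal.Quotient.eq]
  suffices h : (Ideal.Quotient.mkₐ K (Ideal.span {X a - C x * X b})) =
      (Ideal.Quotient.mkₐ K (Ideal.span {X a - C x * X b})).comp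
        (substLine b {a} fun _ => x) from DFunLike.congr_fun h f
  ext1 i
  rcases eq_or_ne i a with rfl | hi
  · rw [AlgHom.comp_apply, substLine_X_of_mem _ (Finset.mem_singleton_self i)]
    exact Ideal.Quotient.eq.mpr (Ideal.mem_span_singleton_self _)
  · rw [AlgHom.comp_apply, substLine_X_of_notMem _ (by simpa using hi)]

theorem prod_range_X_sub {p : ℕ} (hp : 0 < p) {ζ : K} (hζ : IsPrimitiveRoot ζ p) (a b : σ) :
    ∏ j ∈ Finset.range p, (X a - C (ζ ^ j) * X b : MvPolynomial σ K) = X a ^ p - X b ^ p := by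
  classical
  have hC : IsPrimitiveRoot (C ζ : MvPolynomial σ K) p :=
    hζ.map_of_injective (C_injective σ K)
  have : NeZero p := ⟨hp.ne'⟩
  have himage : Polynomial.nthRootsFinset p (1 : MvPolynomial σ K) =
      (Finset.range p).image fun j => C ζ ^ j := by
    ext y
    simp only [Polynomial.mem_nthRootsFinset hp, Finset.mem_image, Finset.mem_range]
    refine ⟨fun h => hC.eq_pow_of_pow_eq_one h, ?_⟩
    rintro ⟨j, -, rfl⟩
    rw [← pow_mul, mul_comm, pow_mul, hC.pow_eq_one, one_pow]
  rw [hC.pow_sub_pow_eq_prod_sub_mul _ _ hp, himage, Finset.prod_image]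
  · simp only [C_pow]
  · intro i hi j hj h
    exact hC.pow_inj (by simpa using hi) (by simpa using hj) h

theorem exists_sub_mul_prod_mem {I : Ideal (MvPolynomial σ K)} {p : ℕ} {ζ : K}
    (hζ : IsPrimitiveRoot ζ p) {a b : σ} (hba : b ≠ a)
    (hb : ∀ g, X b * g ∈ I → g ∈ I)
    (hI : ∀ x : K, ∀ g ∈ I, substLine b {a} (fun _ => x) g ∈ I)
    {f : MvPolynomial σ K} {n : ℕ} (hn : n ≤ p)
    (hf : ∀ j < n, substLine b {a} (fun _ => ζ ^ j) f ∈ I) :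
    ∃ g, f - g * ∏ j ∈ Finset.range n, (X a - C (ζ ^ j) * X b) ∈ I := by
  induction n with
  | zero => exact ⟨f, by simp⟩
  | succ n ih =>
    obtain ⟨g, hg⟩ := ih (by omega) fun j hj => hf j (by omega)
    have hval : substLine b {a} (fun _ => ζ ^ n)
        (∏ j ∈ Finset.range n, (X a - C (ζ ^ j) * X b)) =
          C (∏ j ∈ Finset.range n, (ζ ^ n - ζ ^ j)) * X b ^ n := by
      have hXb : substLine b {a} (fun _ => ζ ^ n) (X b) = X b :=
        substLine_X_of_notMem _ (by simpa using hba)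
      simp only [map_prod, map_sub, map_mul, substLine_C, hXb,
        substLine_X_of_mem _ (Finset.mem_singleton_self a), ← sub_mul, Finset.prod_mul_distrib,
        Finset.prod_const, Finset.card_range]
    have hunit : ∏ j ∈ Finset.range n, (ζ ^ n - ζ ^ j) ≠ 0 := by
      refine Finset.prod_ne_zero_iff.mpr fun j hj h => ?_
      have hjn := Finset.mem_range.mp hj
      have := hζ.pow_inj (by omega) (by omega) (sub_eq_zero.mp h)
      omega
    have hpow : ∀ k (h : MvPolynomial σ K), X b ^ k * h ∈ I → h ∈ I := by
      intro k
      induction k with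
      | zero => simp
      | succ k ihk => exact fun h hh => ihk h (hb _ (by rwa [← mul_assoc, ← pow_succ']))
    have hgI : substLine b {a} (fun _ => ζ ^ n) g ∈ I := by
      have h1 := I.sub_mem (hf n (by omega)) (hI (ζ ^ n) _ hg)
      rw [map_sub, sub_sub_cancel, map_mul, hval] at h1
      refine hpow n _ ?_
      have h2 := I.mul_mem_left (C (∏ j ∈ Finset.range n, (ζ ^ n - ζ ^ j))⁻¹) h1
      convert h2 using 1
      have h3 : (C (∏ j ∈ Finset.range n, (ζ ^ n - ζ ^ j))⁻¹ : MvPolynomial σ K) *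
          C (∏ j ∈ Finset.range n, (ζ ^ n - ζ ^ j)) = 1 := by
        rw [← C_mul, inv_mul_cancel₀ hunit, C_1]
      linear_combination (-(X b ^ n * substLine b {a} (fun _ => ζ ^ n) g)) * h3
    obtain ⟨q, hq⟩ := X_sub_dvd_sub_substLine_singleton a b (ζ ^ n) g
    refine ⟨q, ?_⟩
    have h1 := I.add_mem hg
      (I.mul_mem_right (∏ j ∈ Finset.range n, (X a - C (ζ ^ j) * X b)) hgI)
    rw [Finset.prod_range_succ]
    convert h1 using 1
    linear_combination (∏ j ∈ Finset.range n, (X a - C (ζ ^ j) * X b)) * hq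

theorem mem_powDiffIdeal_iff {p : ℕ} (hp : 0 < p) {ζ : K} (hζ : IsPrimitiveRoot ζ p) {b : σ}
    {S : Finset σ} (hb : b ∉ S) {f : MvPolynomial σ K} :
    f ∈ powDiffIdeal K p b S ↔ ∀ e : σ → K, (∀ i, e i ^ p = 1) → substLine b S e f = 0 := by
  refine ⟨fun hf e he => substLine_eq_zero_of_mem_powDiffIdeal hb he hf, ?_⟩
  induction S using Finset.induction_on generalizing f with
  | empty =>
    intro h
    have h1 := h (fun _ => 1) fun _ => one_pow p
    rw [substLine_empty] at h1
    exact h1 ▸ Ideal.zero_mem _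
  | insert a S ha ih =>
    intro h
    have hbS : b ∉ S := fun h' => hb (Finset.mem_insert_of_mem h')
    have hba : b ≠ a := fun h' => hb (h' ▸ Finset.mem_insert_self _ _)
    obtain ⟨g, hg⟩ := exists_sub_mul_prod_mem (I := powDiffIdeal K p b S) (f := f) hζ hba
      (fun g hg => ih hbS fun e he => by
        have h1 := substLine_eq_zero_of_mem_powDiffIdeal hbS he hg
        rw [map_mul, substLine_X_of_notMem e hbS] at h1
        exact (mul_eq_zero.mp h1).resolve_left (X_ne_zero b))
      (fun x g hg => substLine_singleton_mem_powDiffIdeal ha hba x hg) le_rfl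
      (fun j _ => ih hbS fun e he => by
        rw [substLine_substLine_singleton ha hbS]
        refine h _ fun i => ?_
        rcases eq_or_ne i a with rfl | hi
        · rw [Function.update_self, ← pow_mul, mul_comm, pow_mul, hζ.pow_eq_one, one_pow]
        · rw [Function.update_of_ne hi, he])
    rw [prod_range_X_sub hp hζ] at hg
    have h1 := Ideal.add_mem _ (powDiffIdeal_mono p b (Finset.subset_insert a S) hg)
      (Ideal.mul_mem_left _ g
        (pow_sub_pow_mem_powDiffIdeal p b (Finset.mem_insert_self a S)))
    rwa [sub_add_cancel] at h1

theorem mem_powDiffIdeal_of_mul_mem {p : ℕ} (hp : 0 < p) {ζ : K} (hζ : IsPrimitiveRoot ζ p)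
    {b : σ} {S : Finset σ} (hb : b ∉ S) {r f : MvPolynomial σ K}
    (hr : ∀ e : σ → K, (∀ i, e i ^ p = 1) → substLine b S e r ≠ 0)
    (h : r * f ∈ powDiffIdeal K p b S) : f ∈ powDiffIdeal K p b S := by
  rw [mem_powDiffIdeal_iff hp hζ hb] at h ⊢
  intro e he
  have h1 := h e he
  rw [map_mul] at h1
  exact (mul_eq_zero.mp h1).resolve_left (hr e he)

theorem X_pow_sub_X_pow_ne_zero {p : ℕ} (hp : 0 < p) {a b : σ} (hab : a ≠ b) :
    (X a ^ p - X b ^ p : MvPolynomial σ K) ≠ 0 := by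
  intro h
  have h1 := congrArg (eval fun i => if i = a then (1 : K) else 0) h
  simp [hab.symm, hp.ne'] at h1

theorem substLine_X_pow_sub_sum_pow {ι : Type*} [Fintype ι] [DecidableEq ι] {p : ℕ} {b : ι}
    {S : Finset ι} (hb : b ∉ S) (hS : ∀ i, i ≠ b → i ∈ S) (e c : ι → K) :
    substLine b S e (X b ^ p - (∑ j, C (c j) * X j) ^ p) =
      C (1 - (∑ j, Function.update e b 1 j * c j) ^ p) * X b ^ p := by
  have hsum : substLine b S e (∑ j, C (c j) * X j) =
      C (∑ j, Function.update e b 1 j * c j) * X b := by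
    rw [map_sum, map_sum, Finset.sum_mul]
    refine Finset.sum_congr rfl fun j _ => ?_
    rcases eq_or_ne j b with rfl | hj
    · rw [map_mul, substLine_C, substLine_X_of_notMem e hb, Function.update_self, one_mul]
    · rw [map_mul, substLine_C, substLine_X_of_mem e (hS j hj), Function.update_of_ne hj, C_mul]
      ring
  rw [map_sub, map_pow, map_pow, hsum, substLine_X_of_notMem e hb, mul_pow, map_sub, map_pow, C_1]
  ring

end MvPolynomial

theorem IsPrimitiveRoot.sum_mul_pow_ne_one {ι K : Type*} [Fintype ι] [Field K]
    {p : ℕ} (hp : 0 < p) {ζ : K} (hζ : IsPrimitiveRoot ζ p) {c : ι → K}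
    (hc : ∀ i : ι → Fin p, 1 - ∑ k, ζ ^ (i k : ℕ) * c k ≠ 0)
    {e : ι → K} (he : ∀ i, e i ^ p = 1) : (∑ k, e k * c k) ^ p ≠ 1 := by
  intro hs
  have : NeZero p := ⟨hp.ne'⟩
  set s := ∑ k, e k * c k with hsdef
  have hs0 : s ≠ 0 := by
    intro h
    simp [h, hp.ne'] at hs
  have hroot : ∀ k, ∃ i : Fin p, ζ ^ (i : ℕ) = s⁻¹ * e k := fun k => by
    obtain ⟨i, hi, h⟩ := hζ.eq_pow_of_pow_eq_one (ξ := s⁻¹ * e k)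
      (by rw [mul_pow, inv_pow, hs, he, inv_one, one_mul])
    exact ⟨⟨i, hi⟩, h⟩
  choose i hi using hroot
  refine hc i ?_
  simp only [hi, mul_assoc, ← Finset.mul_sum]
  rw [← hsdef, inv_mul_cancel₀ hs0, sub_self]

/-- for any point `c` with `c_1⋯c_m ≠ 0` lying off the pulled-back singular
locus `R(z) = 0`, the polynomials `M_1 = ξ_1^p − ξ_m^p, …, M_{m−1} = ξ_{m−1}^p − ξ_m^p,
M_m = ξ_m^p − (c_1ξ_1 + ⋯ + c_mξ_m)^p` form a regular sequence in `ℂ[ξ_1,…,ξ_m]`. -/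
theorem FCpm_symbols_regular_sequence_fiber (p m : ℕ) (hp : 2 ≤ p) (hm : 1 ≤ m) (ζ : ℂ)
    (hζ : ζ = Complex.exp (2 * Real.pi * Complex.I / p))
    (c : Fin m → ℂ) (hc0 : ∏ k, c k ≠ 0)
    (hcR : ∏ i : Fin m → Fin p, (1 - ∑ k : Fin m, ζ ^ (i k : ℕ) * c k) ≠ 0)
    (M : Fin m → MvPolynomial (Fin m) ℂ)
    (hM : ∀ k : Fin m, M k =
      if (k : ℕ) < m - 1 then
        X k ^ p - X (⟨m - 1, by omega⟩ : Fin m) ^ p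
      else
        X (⟨m - 1, by omega⟩ : Fin m) ^ p - (∑ j : Fin m, C (c j) * X j) ^ p) :
    RingTheory.Sequence.IsRegular (MvPolynomial (Fin m) ℂ) (List.ofFn M) := by
  have hp0 : 0 < p := by omega
  have hζp : IsPrimitiveRoot ζ p := hζ ▸ Complex.isPrimitiveRoot_exp p hp0.ne'
  set b : Fin m := ⟨m - 1, by omega⟩ with hbdef
  refine ⟨⟨fun i hi => ?_⟩, ?_⟩
  · have him : i < m := by simpa using hi
    set S : Finset (Fin m) := Finset.univ.filter fun k => (k : ℕ) < i with hSdef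
    have hbS : b ∉ S := by
      simp only [hSdef, hbdef, Finset.mem_filter, Finset.mem_univ, true_and]
      omega
    have hideal : Ideal.ofList ((List.ofFn M).take i) = powDiffIdeal ℂ p b S := by
      refine congrArg Ideal.span (Set.ext fun f => ?_)
      simp only [Set.mem_ofPred_eq, List.mem_take_iff_getElem, List.getElem_ofFn, Set.mem_image,
        hSdef, Finset.coe_filter, Finset.mem_univ, true_and, List.length_ofFn]
      constructor
      · rintro ⟨k, hk, rfl⟩
        exact ⟨⟨k, by omega⟩, by simp; omega, by rw [hM, if_pos (by simp; omega)]⟩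
      · rintro ⟨k, hk, rfl⟩
        exact ⟨k, by omega, by rw [hM, if_pos (by simp; omega)]⟩
    rw [isSMulRegular_quotient_iff_mem_of_smul_mem]
    simp only [smul_eq_mul, Ideal.mul_top, hideal, List.getElem_ofFn]
    refine fun f hf => mem_powDiffIdeal_of_mul_mem hp0 hζp hbS (fun e he => ?_) hf
    rw [hM]
    split_ifs with h
    · have hiS : (⟨i, him⟩ : Fin m) ∉ S := by simp [hSdef]
      rw [map_sub, map_pow, map_pow, substLine_X_of_notMem e hiS, substLine_X_of_notMem e hbS]
      refine X_pow_sub_X_pow_ne_zero hp0 fun h' => ?_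
      have := congrArg Fin.val h'
      simp only [hbdef] at this h
      omega
    · have hS : ∀ k, k ≠ b → k ∈ S := fun k hk => by
        have h1 : (k : ℕ) ≠ m - 1 := fun h' => hk (Fin.ext h')
        simp only [hSdef, Finset.mem_filter, Finset.mem_univ, true_and]
        simp only at h
        omega
      rw [substLine_X_pow_sub_sum_pow hbS hS]
      refine mul_ne_zero (fun h0 => ?_) (pow_ne_zero _ (X_ne_zero b))
      rw [C_eq_zero, sub_eq_zero] at h0
      refine hζp.sum_mul_pow_ne_one hp0
        (fun i => Finset.prod_ne_zero_iff.mp hcR i (Finset.mem_univ i)) (fun k => ?_) h0.symm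
      rcases eq_or_ne k b with rfl | hk
      · rw [Function.update_self, one_pow]
      · rw [Function.update_of_ne hk, he]
  · rw [smul_eq_mul, Ideal.mul_top]
    refine fun htop => ?_
    have hle : Ideal.ofList (List.ofFn M) ≤
        RingHom.ker (eval (0 : Fin m → ℂ)) := by
      refine Ideal.span_le.mpr fun f hf => ?_
      obtain ⟨k, rfl⟩ := (List.mem_ofFn' M f).mp hf
      rw [SetLike.mem_coe, RingHom.mem_ker, hM]
      split_ifs <;> simp [hp0.ne']
    have h1 : (1 : MvPolynomial (Fin m) ℂ) ∈ RingHom.ker (eval (0 : Fin m → ℂ)) :=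
      hle (htop ▸ Submodule.mem_top)
    simp at h1
end

section
/- Let p ≥ 2 and m ≥ 1 be integers and ζ = exp(2π√−1/p). Let A be the localization of ℂ[z_1,…,z_m] away from the element z_1⋯z_m·∏_{(i_1,…,i_m)∈{0,…,p−1}^m}(1 − ζ^{i_1}z_1 − ⋯ − ζ^{i_m}z_m). In A[ξ_1,…,ξ_m], set L_k = (z_kξ_k)^p − z_k^p·(z_1ξ_1 + ⋯ + z_mξ_m)^p for k = 1,…,m (z_j denoting the image of z_j in A), and let Q = A[ξ_1,…,ξ_m]/(L_1,…,L_m). Then Q is a finitely generated projective A-module, and for every ring homomorphism ev : A → ℂ of ℂ-algebras (equivalently, every point c ∈ ℂ^m with c_1⋯c_m·∏_{(i_1,…,i_m)}(1 − ζ^{i_1}c_1 − ⋯ − ζ^{i_m}c_m) ≠ 0), the fiber Q ⊗_{A,ev} ℂ is a ℂ-vector space of dimension p^m; that is, Q is locally free of rank p^m over A. -/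
open scoped BigOperators TensorProduct
open MvPolynomial

/-- An algebra with a Casimir element whose contraction along a linear form is a unit is finite
projective as a module. -/
theorem Algebra.finite_projective_of_casimir {R Q : Type*} [CommRing R] [CommRing Q] [Algebra R Q]
    (Δ : Q ⊗[R] Q) (hΔ : ∀ q : Q, q ⊗ₜ[R] 1 * Δ = 1 ⊗ₜ[R] q * Δ) (l : Q →ₗ[R] R)
    (hu : IsUnit (_root_.TensorProduct.lid R Q (_root_.TensorProduct.map l LinearMap.id Δ))) :
    Module.Finite R Q ∧ Module.Projective R Q := by
  obtain ⟨S, rfl⟩ := _root_.TensorProduct.exists_finset Δ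
  obtain ⟨u, hu⟩ := hu
  let F : Q →ₗ[R] (S → R) := LinearMap.pi fun i => l ∘ₗ LinearMap.mulRight R i.1.1
  let G : (S → R) →ₗ[R] Q := ∑ i : S,
    (LinearMap.toSpanSingleton R Q (i.1.2 * (↑u⁻¹ : Q))) ∘ₗ LinearMap.proj i
  have hGF : G ∘ₗ F = LinearMap.id := by
    ext q
    have h := congrArg (fun t => _root_.TensorProduct.lid R Q (_root_.TensorProduct.map l LinearMap.id t)) (hΔ q)
    simp only [Finset.mul_sum, Algebra.TensorProduct.tmul_mul_tmul, one_mul, map_sum,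
      _root_.TensorProduct.map_tmul, _root_.TensorProduct.lid_tmul, LinearMap.id_apply] at h hu
    have h2 : ∑ i ∈ S, l (q * i.1) • i.2 = q * u := by
      rw [h, hu, Finset.mul_sum]
      exact Finset.sum_congr rfl fun i _ => (mul_smul_comm _ _ _).symm
    have h3 : G (F q) = ∑ i ∈ S, l (q * i.1) • (i.2 * (↑u⁻¹ : Q)) := by
      rw [← Finset.sum_coe_sort S]
      simp [F, G]
    change G (F q) = q
    rw [h3]
    simp_rw [← smul_mul_assoc]
    rw [← Finset.sum_mul, h2, mul_assoc, Units.mul_inv, mul_one]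
  exact ⟨Module.Finite.of_surjective G fun q => ⟨F q, LinearMap.congr_fun hGF q⟩,
    Module.Projective.of_split F G hGF⟩

section Residue

variable {σ R : Type*} [Fintype σ] [DecidableEq σ] [CommRing R]

/-- The coefficient of `∏ j, X j ^ n`. -/
noncomputable def topCoeff (σ R : Type*) [Fintype σ] [CommRing R] (n : ℕ) :
    MvPolynomial σ R →ₗ[R] R :=
  lcoeff R (Finsupp.equivFunOnFinite.symm fun _ => n)

omit [DecidableEq σ] in
theorem topCoeff_apply (n : ℕ) (q : MvPolynomial σ R) :
    topCoeff σ R n q = coeff (Finsupp.equivFunOnFinite.symm fun _ => n) q := rfl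

omit [DecidableEq σ] in
theorem topCoeff_X_pow_mul (n : ℕ) (j : σ) (q : MvPolynomial σ R) :
    topCoeff σ R n (X j ^ (n + 1) * q) = 0 := by
  rw [topCoeff_apply, X_pow_eq_monomial, coeff_monomial_mul', if_neg]
  intro h
  simpa using h j

theorem topCoeff_det_eq_zero (n : ℕ) (i : σ) (P : Matrix σ σ (MvPolynomial σ R))
    (hi : P.mulVec X i = 0) (hj : ∀ j ≠ i, P.mulVec X j = X j ^ (n + 1)) :
    topCoeff σ R n P.det = 0 := by
  have h : X i * P.det = ∑ j, P.adjugate i j * P.mulVec X j := by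
    have := congrFun (congrArg (fun M : Matrix σ σ (MvPolynomial σ R) => M.mulVec X)
      P.adjugate_mul) i
    simp only [← Matrix.mulVec_mulVec, Matrix.smul_mulVec, Matrix.one_mulVec, Pi.smul_apply,
      smul_eq_mul] at this
    rw [mul_comm, ← this]
    rfl
  rw [topCoeff_apply, ← coeff_X_mul _ i, h, coeff_sum]
  refine Finset.sum_eq_zero fun j _ => ?_
  by_cases hji : j = i
  · rw [hji, hi, mul_zero, coeff_zero]
  · rw [hj j hji, mul_comm, X_pow_eq_monomial, coeff_monomial_mul', if_neg]
    intro h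
    have := h j
    simp [Ne.symm hji] at this

theorem topCoeff_det_eq_one (n : ℕ) (M : Matrix σ σ (MvPolynomial σ R))
    (hM : ∀ j, M.mulVec X j = X j ^ (n + 1)) : topCoeff σ R n M.det = 1 := by
  let D : Matrix σ σ (MvPolynomial σ R) := Matrix.diagonal fun j => X j ^ n
  have hD : ∀ j, D.mulVec X j = X j ^ (n + 1) := fun j => by
    simp [D, Matrix.mulVec_diagonal, pow_succ]
  have key : ∀ s : Finset σ, topCoeff σ R n (Matrix.det fun j => if j ∈ s then D j else M j) =
      topCoeff σ R n M.det := by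
    intro s
    induction s using Finset.induction_on with
    | empty => simp
    | insert i s his ih =>
      rw [← ih, ← sub_eq_zero, ← map_sub]
      set N : Matrix σ σ (MvPolynomial σ R) := fun j => if j ∈ s then D j else M j with hN
      have hNX : ∀ j, N.mulVec X j = X j ^ (n + 1) := fun j => by
        by_cases hj : j ∈ s
        · rw [← hD j]; simp [Matrix.mulVec, hN, hj]
        · rw [← hM j]; simp [Matrix.mulVec, hN, hj]
      have h1 : (fun j => if j ∈ insert i s then D j else M j) =
          N.updateRow i ((D i - N i) + N i) := by
        ext1 j
        by_cases hj : j = i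
        · subst hj; simp
        · rw [Matrix.updateRow_ne hj]; simp [hj, hN]
      have h2 : Matrix.det (fun j => if j ∈ insert i s then D j else M j) =
          (N.updateRow i (D i - N i)).det + N.det := by
        rw [h1, Matrix.det_updateRow_add, Matrix.updateRow_eq_self]
      rw [h2, add_sub_cancel_right]
      refine topCoeff_det_eq_zero n i _ ?_ fun j hj => ?_
      · have := (hD i).trans (hNX i).symm
        rw [← sub_eq_zero] at this
        rw [← this]
        simp only [Matrix.mulVec, Matrix.updateRow_self]
        exact sub_dotProduct _ _ _
      · rw [← hNX j]
        simp [Matrix.mulVec, Matrix.updateRow_ne hj]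
  rw [← key Finset.univ]
  have : (fun j => if j ∈ Finset.univ then D j else M j) = D := by ext1; simp
  rw [this, Matrix.det_diagonal, topCoeff_apply, coeff_prod_X_pow _ fun _ => n, if_pos]
  ext; simp

omit [Fintype σ] [DecidableEq σ] in
/-- A difference `q ⊗ 1 - 1 ⊗ q` lies in the ideal generated by the differences of variables. -/
theorem tmul_one_sub_one_tmul_mem_span (q : MvPolynomial σ R) :
    q ⊗ₜ[R] (1 : MvPolynomial σ R) - 1 ⊗ₜ[R] q ∈ Ideal.span (Set.range fun j : σ =>
      (X j : MvPolynomial σ R) ⊗ₜ[R] (1 : MvPolynomial σ R) - 1 ⊗ₜ[R] X j) := by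
  set J := Ideal.span (Set.range fun j : σ =>
      (X j : MvPolynomial σ R) ⊗ₜ[R] (1 : MvPolynomial σ R) - 1 ⊗ₜ[R] X j) with hJ
  have h : (Ideal.Quotient.mkₐ R J).comp Algebra.TensorProduct.includeLeft =
      (Ideal.Quotient.mkₐ R J).comp Algebra.TensorProduct.includeRight := by
    ext j
    exact Ideal.Quotient.eq.mpr (Ideal.subset_span ⟨j, rfl⟩)
  exact Ideal.Quotient.eq.mp (AlgHom.congr_fun h q)

omit [Fintype σ] [DecidableEq σ] in
/-- If the variables map to nilpotent elements, then polynomials with constant term one map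
to units. -/
theorem isUnit_of_constantCoeff_eq_one {Q : Type*} [CommRing Q] [Algebra R Q]
    (π : MvPolynomial σ R →ₐ[R] Q) (hX : ∀ j, IsNilpotent (π (X j))) (q : MvPolynomial σ R)
    (hq : constantCoeff q = 1) : IsUnit (π q) := by
  let N := nilradical Q
  have h : (Ideal.Quotient.mk N).comp (π : MvPolynomial σ R →+* Q) =
      ((Ideal.Quotient.mk N).comp (π : MvPolynomial σ R →+* Q)).comp (C.comp constantCoeff) := by
    ext j
    · simp
    · simpa [N, Ideal.Quotient.eq_zero_iff_mem, mem_nilradical] using hX j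
  have h1 : Ideal.Quotient.mk N (π q) = Ideal.Quotient.mk N 1 := by
    simpa [hq] using RingHom.congr_fun h q
  have h2 : IsNilpotent (π q - 1) := Ideal.Quotient.eq.mp h1
  simpa using h2.isUnit_one_add

/-- A quotient of a polynomial ring in finitely many variables by as many polynomials without
constant term, in which the variables are nilpotent, is finite projective over the base. -/
theorem finite_projective_of_isNilpotent {Q : Type*} [CommRing Q] [Algebra R Q]
    (π : MvPolynomial σ R →ₐ[R] Q) (hπ : Function.Surjective π) (f : σ → MvPolynomial σ R)
    (hker : RingHom.ker π = Ideal.span (Set.range f)) (hf : ∀ k, constantCoeff (f k) = 0)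
    (hX : ∀ j, IsNilpotent (π (X j))) : Module.Finite R Q ∧ Module.Projective R Q := by
  have hπf : ∀ k, π (f k) = 0 := fun k =>
    (RingHom.mem_ker (f := π)).mp (hker ▸ Ideal.subset_span ⟨k, rfl⟩)
  obtain ⟨n, hn⟩ : ∃ n : ℕ, ∀ j, (X j : MvPolynomial σ R) ^ (n + 1) ∈ Ideal.span (Set.range f) := by
    choose e he using hX
    refine ⟨∑ j, e j, fun j => ?_⟩
    rw [← hker, RingHom.mem_ker, map_pow]
    exact pow_eq_zero_of_le
      ((Finset.single_le_sum (fun _ _ => Nat.zero_le _) (Finset.mem_univ j)).trans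
        (Nat.le_succ _)) (he j)
  choose a ha using fun j => Ideal.mem_span_range_iff_exists_fun.mp (hn j)
  choose b hb using fun k =>
    Ideal.mem_span_range_iff_exists_fun.mp (tmul_one_sub_one_tmul_mem_span (f k))
  let a' : Matrix σ σ (MvPolynomial σ R) := a
  let b' : Matrix σ σ (MvPolynomial σ R ⊗[R] MvPolynomial σ R) := b
  have ha' : a'.mulVec f = fun j => X j ^ (n + 1) := by
    ext1 j; exact ha j
  let l' : MvPolynomial σ R →ₗ[R] R := topCoeff σ R n ∘ₗ LinearMap.mulLeft R a'.det
  have hl' : LinearMap.ker π.toLinearMap ≤ LinearMap.ker l' := by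
    intro q hq
    have hq' : q ∈ RingHom.ker π := hq
    rw [hker] at hq'
    obtain ⟨c, rfl⟩ := Ideal.mem_span_range_iff_exists_fun.mp hq'
    have h : ∀ k, a'.det * f k = ∑ j, a'.adjugate k j * X j ^ (n + 1) := fun k => by
      have := congrFun (congrArg (fun M : Matrix σ σ (MvPolynomial σ R) => M.mulVec f) a'.adjugate_mul) k
      simp only [← Matrix.mulVec_mulVec, Matrix.smul_mulVec, Matrix.one_mulVec, Pi.smul_apply,
        smul_eq_mul, ha'] at this
      exact this.symm
    rw [LinearMap.mem_ker, LinearMap.comp_apply, LinearMap.mulLeft_apply, Finset.mul_sum, map_sum]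
    refine Finset.sum_eq_zero fun k _ => ?_
    rw [mul_left_comm, h, Finset.mul_sum, map_sum]
    refine Finset.sum_eq_zero fun j _ => ?_
    rw [← mul_assoc, mul_comm, topCoeff_X_pow_mul]
  obtain ⟨l, hl⟩ : ∃ l : Q →ₗ[R] R, ∀ x, l (π x) = l' x := by
    refine ⟨(LinearMap.ker π.toLinearMap).liftQ l' hl' ∘ₗ
      (π.toLinearMap.quotKerEquivOfSurjective hπ).symm.toLinearMap, fun x => ?_⟩
    have : (π.toLinearMap.quotKerEquivOfSurjective hπ).symm (π x) = Submodule.Quotient.mk x := by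
      rw [LinearEquiv.symm_apply_eq]; rfl
    simp [this]
  let ππ : MvPolynomial σ R ⊗[R] MvPolynomial σ R →ₐ[R] (Q) ⊗[R] (Q) := Algebra.TensorProduct.map π π
  refine Algebra.finite_projective_of_casimir (ππ b'.det) ?_ l ?_
  · have hX0 : ∀ j, ππ (((X j : MvPolynomial σ R) ⊗ₜ[R] (1 : MvPolynomial σ R) - 1 ⊗ₜ[R] X j) * b'.det) = 0 := fun j => by
      have := congrFun (congrArg (fun M : Matrix σ σ (MvPolynomial σ R ⊗[R] MvPolynomial σ R) =>
        M.mulVec (fun j => (X j : MvPolynomial σ R) ⊗ₜ[R] (1 : MvPolynomial σ R) - 1 ⊗ₜ[R] X j)) b'.adjugate_mul) j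
      have hb' : b'.mulVec (fun j => (X j : MvPolynomial σ R) ⊗ₜ[R] (1 : MvPolynomial σ R) - 1 ⊗ₜ[R] X j) =
          fun k => f k ⊗ₜ[R] 1 - 1 ⊗ₜ[R] f k := by
        ext1 k; exact hb k
      simp only [← Matrix.mulVec_mulVec, Matrix.smul_mulVec, Matrix.one_mulVec, Pi.smul_apply,
        smul_eq_mul, hb'] at this
      rw [mul_comm, ← this]
      simp [Matrix.mulVec, dotProduct, ππ, hπf]
    intro q
    obtain ⟨q, rfl⟩ := hπ q
    obtain ⟨c, hc⟩ := Ideal.mem_span_range_iff_exists_fun.mp (tmul_one_sub_one_tmul_mem_span q)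
    rw [← sub_eq_zero, ← sub_mul]
    have : π q ⊗ₜ[R] 1 - 1 ⊗ₜ[R] π q = ππ (q ⊗ₜ[R] 1 - 1 ⊗ₜ[R] q) := by simp [ππ]
    rw [this, ← map_mul, ← hc, Finset.sum_mul, map_sum]
    refine Finset.sum_eq_zero fun j _ => ?_
    rw [mul_assoc, map_mul, hX0, mul_zero]
  · let ε : MvPolynomial σ R →ₐ[R] R := aeval 0
    have h1 : ∀ t, TensorProduct.lid R _ (TensorProduct.map l LinearMap.id (ππ t)) =
        π (TensorProduct.lid R _ (TensorProduct.map l' LinearMap.id t)) := by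
      intro t
      induction t with
      | zero => simp
      | add x y hx hy => simp only [map_add, hx, hy]
      | tmul x y =>
        simp [ππ, hl]
    let η : MvPolynomial σ R ⊗[R] MvPolynomial σ R →ₐ[R] MvPolynomial σ R := Algebra.TensorProduct.lift (AlgHom.id R _)
      ((Algebra.ofId R _).comp ε) fun _ _ => Commute.all _ _
    have h2 : ∀ t, ε (TensorProduct.lid R _ (TensorProduct.map l' LinearMap.id t)) =
        l' (η t) := by
      intro t
      induction t with
      | zero => simp
      | add x y hx hy => simp only [map_add, hx, hy]
      | tmul x y =>
        have : η (x ⊗ₜ y) = ε y • x := by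
          simp [η, Algebra.smul_def, mul_comm, Algebra.ofId_apply]
        rw [this]
        simp [mul_comm]
    rw [h1]
    refine isUnit_of_constantCoeff_eq_one π hX _ ?_
    have hε : ∀ q, constantCoeff q = ε q := fun q => by
      simp only [ε, aeval_zero, Algebra.algebraMap_self_apply]
    rw [hε, h2]
    change topCoeff σ R n (a'.det * η b'.det) = 1
    rw [AlgHom.map_det, ← Matrix.det_mul]
    refine topCoeff_det_eq_one n _ fun j => ?_
    rw [← Matrix.mulVec_mulVec]
    have : (η.mapMatrix b').mulVec X = f := by
      ext1 k
      have := congrArg η (hb k)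
      have hk := hε (f k)
      rw [hf] at hk
      simp [η, ← hk] at this
      simpa [ε, η, Matrix.mulVec, dotProduct] using this
    rw [this, ha']

end Residue

section Rank

theorem finrank_tensorProduct_eq_rankAtStalk_bot {R K M : Type*} [CommRing R] [IsDomain R]
    [Field K] [Algebra R K] [AddCommGroup M] [Module R M] [Module.Finite R M]
    [Module.Projective R M] :
    Module.finrank K (K ⊗[R] M) = Module.rankAtStalk M (⊥ : PrimeSpectrum R) := by
  have h := Module.rankAtStalk_baseChange (R := R) (M := M) (⊥ : PrimeSpectrum K)
  rw [Module.rankAtStalk_eq_finrank_of_free] at h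
  rw [Module.rankAtStalk_eq_of_le_of_finite_of_flat M
    (bot_le : ⊥ ≤ PrimeSpectrum.comap (algebraMap R K) ⊥), ← h]
  rfl

theorem finrank_tensorProduct_quotient {σ ι R K : Type*} [CommRing R] [Field K] [Algebra R K]
    (f : ι → MvPolynomial σ R) :
    Module.finrank K (K ⊗[R] (MvPolynomial σ R ⧸ Ideal.span (Set.range f))) =
      Module.finrank K (MvPolynomial σ K ⧸
        Ideal.span (Set.range fun k => map (algebraMap R K) (f k))) := by
  refine LinearEquiv.finrank_eq (AlgEquiv.toLinearEquiv
    ((Algebra.TensorProduct.tensorQuotientEquiv K (MvPolynomial σ R) K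
      (Ideal.span (Set.range f))).trans
    (Ideal.quotientEquivAlg _ _ (algebraTensorAlgEquiv R K) ?_)))
  rw [Ideal.map_span, Ideal.map_span, ← Set.range_comp, ← Set.range_comp]
  congr 2
  ext1 k
  simp

/-- Monomials with all exponents below `p` give coordinates modulo the `p`-th powers of the
variables. -/
theorem finrank_quotient_X_pow (p m : ℕ) (K : Type*) [Field K] :
    Module.finrank K (MvPolynomial (Fin m) K ⧸
      Ideal.span (Set.range fun k : Fin m => (X k : MvPolynomial (Fin m) K) ^ p)) = p ^ m := by
  let F : MvPolynomial (Fin m) K →ₗ[K] ((Fin m → Fin p) → K) :=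
    LinearMap.pi fun a => lcoeff K (Finsupp.equivFunOnFinite.symm fun j => (a j : ℕ))
  have hF : ∀ q a, F q a = coeff (Finsupp.equivFunOnFinite.symm fun j => (a j : ℕ)) q :=
    fun _ _ => rfl
  have hsurj : Function.Surjective F := by
    intro v
    refine ⟨∑ a, monomial (Finsupp.equivFunOnFinite.symm fun j => (a j : ℕ)) (v a), ?_⟩
    ext b
    rw [hF, coeff_sum, Finset.sum_eq_single b]
    · simp
    · intro a _ hab
      rw [coeff_monomial, if_neg]
      intro h
      refine hab (funext fun j => Fin.ext ?_)
      simpa using DFunLike.congr_fun h j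
    · simp
  have hker : LinearMap.ker F = (Ideal.span (Set.range fun k : Fin m =>
      (X k : MvPolynomial (Fin m) K) ^ p)).restrictScalars K := by
    ext q
    have h1 : (Set.range fun k : Fin m => (X k : MvPolynomial (Fin m) K) ^ p) =
        (fun s => monomial s (1 : K)) '' Set.range fun k : Fin m => Finsupp.single k p := by
      rw [← Set.range_comp]
      congr 1
      ext1 k
      simp [X_pow_eq_monomial]
    rw [Submodule.restrictScalars_mem, h1, mem_ideal_span_monomial_image, LinearMap.mem_ker]
    simp only [Set.exists_range_iff, Finsupp.single_le_iff]
    constructor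
    · intro h s hs
      by_contra! hlt
      refine mem_support_iff.mp hs ?_
      have := (hF q fun j => ⟨s j, hlt j⟩).symm.trans (congrFun h _)
      simpa using this
    · intro h
      ext a
      rw [hF]
      by_contra hne
      obtain ⟨k, hk⟩ := h _ (mem_support_iff.mpr hne)
      have := (a k).isLt
      simp at hk
      omega
  have e := (Submodule.quotEquivOfEq _ _ hker).symm.trans (F.quotKerEquivOfSurjective hsurj)
  have e' := (Submodule.Quotient.restrictScalarsEquiv K (Ideal.span (Set.range fun k : Fin m =>
      (X k : MvPolynomial (Fin m) K) ^ p))).symm.trans e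
  rw [e'.finrank_eq]
  simp

end Rank

section Symbol

theorem isNilpotent_of_pow_eq_sum_pow {p : ℕ} (hp : p ≠ 0) {ζ : ℂ} (hζ : IsPrimitiveRoot ζ p)
    {σ S : Type*} [Fintype σ] [CommRing S] [Algebra ℂ S] (z x : σ → S)
    (hx : ∀ k, x k ^ p = (∑ j, z j * x j) ^ p)
    (hu : ∀ i : σ → Fin p, IsUnit (1 - ∑ k, algebraMap ℂ S (ζ ^ (i k : ℕ)) * z k)) (k : σ) :
    IsNilpotent (x k) := by
  have : NeZero p := ⟨hp⟩
  rw [nilpotent_iff_mem_prime]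
  intro J hJ
  let π := Ideal.Quotient.mk J
  obtain ⟨s, hs⟩ : ∃ s, s = ∑ j, z j * x j := ⟨_, rfl⟩
  simp only [← hs] at hx
  have hζ' : IsPrimitiveRoot (π (algebraMap ℂ S ζ)) p :=
    hζ.map_of_injective (f := π.comp (algebraMap ℂ S)) (RingHom.injective _)
  have h : ∀ k, ∃ i : Fin p, π (x k) = π (algebraMap ℂ S (ζ ^ (i : ℕ))) * π s := fun k => by
    have h0 : π (x k) ^ p - π s ^ p = 0 := by rw [← map_pow, hx, map_pow, sub_self]
    rw [hζ'.pow_sub_pow_eq_prod_sub_mul _ _ (Nat.pos_of_ne_zero hp), Finset.prod_eq_zero_iff] at h0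
    obtain ⟨μ, hμ, h0⟩ := h0
    rw [Polynomial.mem_nthRootsFinset (Nat.pos_of_ne_zero hp)] at hμ
    obtain ⟨i, hi, rfl⟩ := hζ'.eq_pow_of_pow_eq_one hμ
    exact ⟨⟨i, hi⟩, by simpa using sub_eq_zero.mp h0⟩
  choose i hi using h
  have hs0 : π (1 - ∑ k, algebraMap ℂ S (ζ ^ (i k : ℕ)) * z k) * π s = 0 := by
    have h1 : π s = ∑ j, π (z j) * π (x j) := by rw [hs]; simp
    rw [map_sub, sub_mul, map_one, one_mul, map_sum, Finset.sum_mul, sub_eq_zero]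
    refine h1.trans (Finset.sum_congr rfl fun j _ => ?_)
    rw [hi j, map_mul]
    ring
  have hs1 : π s = 0 := ((hu i).map π).mul_right_eq_zero.mp hs0
  rw [← Ideal.Quotient.eq_zero_iff_mem]
  change π (x k) = 0
  rw [hi k, hs1, mul_zero]

/-- The polynomials `ξ_k ^ p - (∑ j, z_j ξ_j) ^ p`. -/
noncomputable def symbolPoly {σ R : Type*} [Fintype σ] [CommRing R] (p : ℕ) (z : σ → R) (k : σ) :
    MvPolynomial σ R :=
  X k ^ p - (∑ j, C (z j) * X j) ^ p

theorem finite_projective_symbolPoly {p : ℕ} (hp : p ≠ 0) {ζ : ℂ} (hζ : IsPrimitiveRoot ζ p)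
    {σ R : Type*} [Fintype σ] [DecidableEq σ] [CommRing R] [Algebra ℂ R] (z : σ → R)
    (hu : ∀ i : σ → Fin p, IsUnit (1 - ∑ k, algebraMap ℂ R (ζ ^ (i k : ℕ)) * z k)) :
    Module.Finite R (MvPolynomial σ R ⧸ Ideal.span (Set.range (symbolPoly p z))) ∧
      Module.Projective R (MvPolynomial σ R ⧸ Ideal.span (Set.range (symbolPoly p z))) := by
  let π := Ideal.Quotient.mkₐ R (Ideal.span (Set.range (symbolPoly p z)))
  refine finite_projective_of_isNilpotent π (Ideal.Quotient.mkₐ_surjective _ _) (symbolPoly p z)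
    (Ideal.Quotient.mkₐ_ker R _) (fun k => by simp [symbolPoly, hp]) ?_
  refine isNilpotent_of_pow_eq_sum_pow hp hζ (fun k => algebraMap R _ (z k)) (fun k => π (X k))
    (fun k => ?_) fun i => ?_
  · have h : π (symbolPoly p z k) = 0 :=
      Ideal.Quotient.eq_zero_iff_mem.mpr (Ideal.subset_span ⟨k, rfl⟩)
    have hC : ∀ a : R, π (C a) = algebraMap R _ a := fun a => rfl
    simpa [symbolPoly, sub_eq_zero, hC] using h
  · have := (hu i).map (algebraMap R (MvPolynomial σ R ⧸ Ideal.span (Set.range (symbolPoly p z))))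
    simpa [map_sub, map_sum, map_mul, ← IsScalarTower.algebraMap_apply] using this

theorem map_symbolPoly {σ R S : Type*} [Fintype σ] [CommRing R] [CommRing S] (p : ℕ)
    (φ : R →+* S) (z : σ → R) (k : σ) :
    map φ (symbolPoly p z k) = symbolPoly p (fun j => φ (z j)) k := by
  simp [symbolPoly]

theorem finrank_tensorProduct_symbolPoly {σ R K : Type*} [Fintype σ] [CommRing R] [Field K]
    [Algebra R K] (p : ℕ) (z : σ → R) :
    Module.finrank K (K ⊗[R] (MvPolynomial σ R ⧸ Ideal.span (Set.range (symbolPoly p z)))) =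
      Module.finrank K (MvPolynomial σ K ⧸
        Ideal.span (Set.range (symbolPoly p fun j => algebraMap R K (z j)))) := by
  rw [finrank_tensorProduct_quotient, funext fun k => map_symbolPoly p (algebraMap R K) z k]

theorem finrank_symbolPoly {p m : ℕ} (hp : p ≠ 0) {ζ : ℂ} (hζ : IsPrimitiveRoot ζ p)
    (c : Fin m → ℂ) (hc : ∀ i : Fin m → Fin p, 1 - ∑ k, ζ ^ (i k : ℕ) * c k ≠ 0) :
    Module.finrank ℂ (MvPolynomial (Fin m) ℂ ⧸ Ideal.span (Set.range (symbolPoly p c))) =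
      p ^ m := by
  let u : (Fin m → Fin p) → Polynomial ℂ := fun i =>
    1 - ∑ k, Polynomial.C (ζ ^ (i k : ℕ)) * (Polynomial.C (c k) * Polynomial.X)
  let g := ∏ i, u i
  have hev : ∀ t : ℂ, ∀ i, (u i).eval t = 1 - t * ∑ k, ζ ^ (i k : ℕ) * c k := fun t i => by
    simp only [u, Polynomial.eval_sub, Polynomial.eval_one, Polynomial.eval_finsetSum,
      Polynomial.eval_mul, Polynomial.eval_C, Polynomial.eval_X, Finset.mul_sum]
    congr 1
    exact Finset.sum_congr rfl fun k _ => by ring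
  have h0 : IsUnit (Polynomial.evalRingHom (0 : ℂ) g) := by
    simp [g, hev]
  have h1 : IsUnit (Polynomial.evalRingHom (1 : ℂ) g) := by
    simp [g, hev, Finset.prod_ne_zero_iff, hc]
  have hg : g ≠ 0 := by
    intro h
    simp [h] at h1
  let B := Localization.Away g
  have : IsDomain B :=
    IsLocalization.isDomain_localization (powers_le_nonZeroDivisors_of_noZeroDivisors hg)
  let z : Fin m → B := fun k => algebraMap _ B (Polynomial.C (c k) * Polynomial.X)
  have hu : ∀ i : Fin m → Fin p, IsUnit (1 - ∑ k, algebraMap ℂ B (ζ ^ (i k : ℕ)) * z k) := by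
    intro i
    have hgu : IsUnit (∏ i, algebraMap _ B (u i)) := by
      rw [← map_prod]
      exact IsLocalization.Away.algebraMap_isUnit g
    have := (IsUnit.prod_univ_iff.mp hgu) i
    simpa only [u, map_sub, map_one, map_sum, map_mul, z, ← Polynomial.algebraMap_eq,
      ← IsScalarTower.algebraMap_apply] using this
  obtain ⟨hfin, hproj⟩ := finite_projective_symbolPoly hp hζ z hu
  have key : ∀ (φ : B →+* ℂ) (c' : Fin m → ℂ), (∀ k, φ (z k) = c' k) →
      Module.finrank ℂ (MvPolynomial (Fin m) ℂ ⧸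
      Ideal.span (Set.range (symbolPoly p c'))) = Module.rankAtStalk
        (MvPolynomial (Fin m) B ⧸ Ideal.span (Set.range (symbolPoly p z)))
        (⊥ : PrimeSpectrum B) := by
    intro φ c' h
    obtain rfl : (fun k => φ (z k)) = c' := funext h
    let := φ.toAlgebra
    rw [← finrank_tensorProduct_eq_rankAtStalk_bot (K := ℂ), finrank_tensorProduct_symbolPoly]
    rfl
  have hz : ∀ (t : ℂ) (ht : IsUnit (Polynomial.evalRingHom t g)) (k : Fin m),
      (IsLocalization.Away.lift (S := B) g ht) (z k) = c k * t := fun t ht k => by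
    simp [z]
  have e0 := key _ (fun _ => 0) fun k => (hz 0 h0 k).trans (mul_zero _)
  have e1 := key _ c fun k => (hz 1 h1 k).trans (mul_one _)
  rw [e1, ← e0, ← finrank_quotient_X_pow p m ℂ]
  have : (symbolPoly p fun _ : Fin m => (0 : ℂ)) = fun k => X k ^ p := by
    ext1 k
    simp [symbolPoly, hp]
  rw [this]

end Symbol

/-- the quotient `Q = A[ξ_1,…,ξ_m]/(L_1,…,L_m)` of the symbol ideal of the
pulled-back hypergeometric system, over `A = ℂ[z^±, 1/R(z)]` (realized as any localization
of `ℂ[z_1,…,z_m]` away from `z_1⋯z_m·R(z)`), is a finitely generated projective `A`-module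
all of whose fibers at `ℂ`-points of `A` have dimension `p^m`; i.e. `Q` is locally free of
rank `p^m` over `A`. -/
theorem FCpm_symbol_quotient_locally_free (p m : ℕ) (hp : 2 ≤ p) (hm : 1 ≤ m) (ζ : ℂ)
    (hζ : ζ = Complex.exp (2 * Real.pi * Complex.I / p))
    (r : MvPolynomial (Fin m) ℂ)
    (hr : r = (∏ k : Fin m, X k) *
      ∏ i : Fin m → Fin p, (1 - ∑ k : Fin m, C (ζ ^ (i k : ℕ)) * X k))
    (A : Type*) [CommRing A] [Algebra ℂ A] [Algebra (MvPolynomial (Fin m) ℂ) A]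
    [IsScalarTower ℂ (MvPolynomial (Fin m) ℂ) A] [IsLocalization.Away r A]
    (L : Fin m → MvPolynomial (Fin m) A)
    (hL : ∀ k : Fin m, L k =
      (C (algebraMap (MvPolynomial (Fin m) ℂ) A (X k)) * X k) ^ p -
        C (algebraMap (MvPolynomial (Fin m) ℂ) A (X k)) ^ p *
          (∑ j : Fin m, C (algebraMap (MvPolynomial (Fin m) ℂ) A (X j)) * X j) ^ p) :
    Module.Finite A (MvPolynomial (Fin m) A ⧸ Ideal.span (Set.range L)) ∧
    Module.Projective A (MvPolynomial (Fin m) A ⧸ Ideal.span (Set.range L)) ∧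
    ∀ ev : A →ₐ[ℂ] ℂ,
      letI : Algebra A ℂ := ev.toRingHom.toAlgebra
      Module.finrank ℂ
        (TensorProduct A ℂ (MvPolynomial (Fin m) A ⧸ Ideal.span (Set.range L))) =
      p ^ m := by
  have hp0 : p ≠ 0 := by omega
  have hζ' : IsPrimitiveRoot ζ p := hζ ▸ Complex.isPrimitiveRoot_exp p hp0
  let z : Fin m → A := fun k => algebraMap (MvPolynomial (Fin m) ℂ) A (X k)
  have hru : IsUnit (algebraMap (MvPolynomial (Fin m) ℂ) A r) :=
    IsLocalization.Away.algebraMap_isUnit r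
  rw [hr, map_mul, map_prod, map_prod, IsUnit.mul_iff, IsUnit.prod_univ_iff,
    IsUnit.prod_univ_iff] at hru
  obtain ⟨hz, hu⟩ := hru
  have hu' : ∀ i : Fin m → Fin p,
      IsUnit (1 - ∑ k, algebraMap ℂ A (ζ ^ (i k : ℕ)) * z k) := fun i => by
    simpa only [map_sub, map_one, map_sum, map_mul, z, ← MvPolynomial.algebraMap_eq,
      ← IsScalarTower.algebraMap_apply] using hu i
  have hspan : Ideal.span (Set.range L) = Ideal.span (Set.range (symbolPoly p z)) := by
    have hLk : ∀ k, L k = C (z k) ^ p * symbolPoly p z k := fun k => by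
      rw [hL, symbolPoly, mul_sub, mul_pow]
    have hCu : ∀ k, IsUnit ((C (z k) : MvPolynomial (Fin m) A) ^ p) := fun k =>
      ((hz k).map C).pow p
    apply le_antisymm <;> rw [Ideal.span_le, Set.range_subset_iff] <;> intro k
    · rw [hLk]
      exact Ideal.mul_mem_left _ _ (Ideal.subset_span ⟨k, rfl⟩)
    · rw [SetLike.mem_coe, ← Ideal.unit_mul_mem_iff_mem _ (hCu k), ← hLk]
      exact Ideal.subset_span ⟨k, rfl⟩
  rw [hspan]
  obtain ⟨hfin, hproj⟩ := finite_projective_symbolPoly hp0 hζ' z hu'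
  refine ⟨hfin, hproj, fun ev => ?_⟩
  let : Algebra A ℂ := ev.toRingHom.toAlgebra
  change Module.finrank ℂ (ℂ ⊗[A] (MvPolynomial (Fin m) A ⧸ _)) = p ^ m
  rw [finrank_tensorProduct_symbolPoly]
  refine finrank_symbolPoly hp0 hζ' _ fun i => ?_
  have h := ((hu' i).map ev).ne_zero
  simp only [map_sub, map_one, map_sum, map_mul, AlgHom.commutes,
    Algebra.algebraMap_self_apply] at h
  exact h
end
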